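/- arXiv:0807.2345 — 4 statements merged into one kernel-verified Lean document; each statement's English description precedes it below -/
import Mathlib

section
/- For every integer n ≥ 13 the following identity holds in ℚ: Σ_{ℓ=3}^{⌊(n−1)/2⌋} (−1)^{ℓ−1} · C(n−ℓ−5, ℓ−2) · 3/(C(ℓ,2)·C(2ℓ−1, ℓ−1)) = (n−7)(n−8)/((n−4)(n−5)). -/
lemma ps_choose_step (A k : ℕ) :
    (A.choose (k+1) : ℚ) * (k+1) * (A+1) = ((A+1).choose k : ℚ) * ((A:ℚ)+1-k) * ((A:ℚ)-k) := by
  rcases Nat.lt_trichotomy k (A+1) with h | h | h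
  · obtain ⟨d, rfl⟩ := Nat.exists_eq_add_of_le (Nat.lt_succ_iff.mp h)
    have h1 := Nat.choose_succ_right_eq (k+d) k
    have h2 := Nat.choose_mul_succ_eq (k+d) k
    rw [show k + d - k = d by omega] at h1
    rw [show k + d + 1 - k = d + 1 by omega] at h2
    qify at h1 h2
    push_cast
    linear_combination ((k:ℚ)+d+1) * h1 + (d:ℚ) * h2
  · subst h
    rw [Nat.choose_eq_zero_of_lt (show A < A+1+1 by omega)]
    push_cast; ring
  · rw [Nat.choose_eq_zero_of_lt (show A < k+1 by omega),
      Nat.choose_eq_zero_of_lt (show A+1 < k by omega)]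
    simp

lemma ps_central_step (k : ℕ) :
    ((2*k+5).choose (k+2) : ℚ) * (k+3) = 2 * (2*k+5) * ((2*k+3).choose (k+1) : ℚ) := by
  have h1 := Nat.choose_mul_succ_eq (2*k+4) (k+2)
  have h2 := Nat.add_one_mul_choose_eq (2*k+3) (k+1)
  rw [show 2*k+4+1-(k+2) = k+3 by omega] at h1
  qify at h1 h2
  have h3 : ((k:ℚ)+2) ≠ 0 := by positivity
  apply mul_left_cancel₀ h3
  norm_num [add_assoc] at h1 h2
  linear_combination (-(k:ℚ)-2) * h1 - (2*k+5) * h2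

/-- The shifted summand. -/
def psTerm (m k : ℕ) : ℚ :=
  (-1 : ℚ) ^ k * ((m - k).choose k : ℚ) *
    (3 / (((k+2).choose 2 : ℚ) * ((2*k+3).choose (k+1) : ℚ)))

lemma psTerm_step (m k : ℕ) (h : k < m) :
    psTerm m (k+1) * (((m:ℚ)-k) * (2 * (2*k+5))) = - (((m:ℚ)-2*k) * ((m:ℚ)-2*k-1)) * psTerm m k := by
  obtain ⟨A, rfl⟩ := Nat.exists_eq_add_of_lt h
  have h1 := ps_choose_step A k
  have h2 := ps_central_step k
  unfold psTerm
  rw [show k + A + 1 - (k+1) = A by omega, show k + A + 1 - k = A+1 by omega,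
    show 2*(k+1)+3 = 2*k+5 by ring, show k+1+1 = k+2 by ring]
  have hp : ((2*k+3).choose (k+1) : ℚ) ≠ 0 := by
    exact_mod_cast (Nat.choose_pos (by omega)).ne'
  have hq : ((2*k+5).choose (k+2) : ℚ) = 2 * (2*k+5) * ((2*k+3).choose (k+1) : ℚ) / (k+3) := by
    rw [eq_div_iff (by positivity)]; exact h2
  have hr : (A.choose (k+1) : ℚ) = ((A+1).choose k : ℚ) * ((A:ℚ)+1-k) * ((A:ℚ)-k) / ((k+1)*(A+1)) := by
    rw [eq_div_iff (by positivity)]; linear_combination h1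
  rw [hq, hr, Nat.cast_choose_two, Nat.cast_choose_two, pow_succ]
  push_cast
  have e1 : ((k:ℚ)+1+2-1) = k+2 := by ring
  have e2 : ((k:ℚ)+2-1) = k+1 := by ring
  have e3 : ((k:ℚ)+1+2) = k+3 := by ring
  have e4 : ((k:ℚ)+A+1-k) = A+1 := by ring
  rw [e1, e2, e3, e4]
  field_simp
  ring

lemma ps_sum (m K : ℕ) (h : K ≤ m) :
    (∑ k ∈ Finset.range K, psTerm m k) * (((m:ℚ)+2)*(m+3)) =
      ((K:ℚ)-1-m) * (4*K+6) * psTerm m K + 6 * (m+1) := by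
  induction K with
  | zero => norm_num [psTerm]; ring
  | succ K ih =>
    rw [Finset.sum_range_succ, add_mul, ih (by omega)]
    have := psTerm_step m K (by omega)
    push_cast
    linear_combination this

theorem pfaff_saalschuetz_identity_one (n : ℕ) (hn : 13 ≤ n) :
    ∑ ℓ ∈ Finset.Icc 3 ((n - 1) / 2),
      (-1 : ℚ) ^ (ℓ - 1) * ((n - ℓ - 5).choose (ℓ - 2) : ℚ) *
        (3 / ((ℓ.choose 2 : ℚ) * ((2 * ℓ - 1).choose (ℓ - 1) : ℚ))) =
      ((n : ℚ) - 7) * ((n : ℚ) - 8) / (((n : ℚ) - 4) * ((n : ℚ) - 5)) := by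
  obtain ⟨m, rfl⟩ : ∃ m, n = m + 7 := ⟨n - 7, by omega⟩
  obtain ⟨K, hK⟩ : ∃ K, (m + 7 - 1) / 2 = K + 2 := ⟨(m+7-1)/2 - 2, by omega⟩
  have hs := ps_sum m (K+1) (by omega)
  have hz : psTerm m (K+1) = 0 := by
    unfold psTerm
    rw [Nat.choose_eq_zero_of_lt (show m - (K+1) < K+1 by omega)]
    simp
  rw [hz, Finset.sum_range_succ'] at hs
  have h0 : psTerm m 0 = 1 := by norm_num [psTerm]
  have hI : Finset.Icc 3 ((m + 7 - 1) / 2) = Finset.Ico (0+3) (K+3) := by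
    rw [hK]; ext x; simp only [Finset.mem_Icc, Finset.mem_Ico]; omega
  rw [hI, ← Finset.sum_Ico_add', ← Finset.range_eq_Ico]
  have hc : ∀ k ∈ Finset.range K, (-1 : ℚ) ^ (k + 3 - 1) * ((m + 7 - (k+3) - 5).choose (k + 3 - 2) : ℚ) *
        (3 / (((k+3).choose 2 : ℚ) * ((2 * (k+3) - 1).choose (k + 3 - 1) : ℚ))) = - psTerm m (k+1) := by
    intro k _
    unfold psTerm
    rw [show k + 3 - 1 = k + 1 + 1 by omega, show m + 7 - (k+3) - 5 = m - (k+1) by omega,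
      show k + 3 - 2 = k + 1 by omega, show 2 * (k+3) - 1 = 2 * (k+1) + 3 by omega, pow_succ]
    ring
  rw [Finset.sum_congr rfl hc, Finset.sum_neg_distrib]
  rw [h0] at hs
  push_cast
  have e1 : ((m:ℚ)+7-4) = m+3 := by ring
  have e2 : ((m:ℚ)+7-5) = m+2 := by ring
  rw [e1, e2, eq_div_iff (by positivity)]
  linear_combination -hs
end

section
/- For every integer n ≥ 13 the following identity holds in ℚ: Σ_{ℓ=5}^{⌊(n−1)/2⌋} (−1)^{ℓ} · C(n−ℓ−5, ℓ−4) · 3/(C(ℓ,2)·C(2ℓ−1, ℓ−1)) = −1/70 + 12(n−8)/((n−2)(n−3)(n−4)(n−5)). -/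
/-- The coefficient `α_{k+4}`. -/
def psAlpha (k : ℕ) : ℚ :=
  3 / (((k + 4).choose 2 : ℚ) * ((2 * k + 7).choose (k + 3) : ℚ))

/-- The shifted summand, `ℓ = k + 4`, `n = m + 9`. -/
def psF (m k : ℕ) : ℚ := (-1) ^ k * ((m - k).choose k : ℚ) * psAlpha k

/-- The reciprocal of the claimed closed form. -/
def psR (m : ℕ) : ℚ :=
  (((m : ℚ) + 7) * (m + 6) * (m + 5) * (m + 4)) / (12 * (m + 1))

theorem psAlpha_succ (k : ℕ) :
    psAlpha k * (k + 3) = 2 * (2 * k + 9) * psAlpha (k + 1) := by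
  have h1 : ((2 * (k + 1) + 7).choose (k + 1 + 3) : ℚ) * ((k + 4) * (k + 5)) =
      ((2 * k + 7).choose (k + 3) : ℚ) * ((2 * k + 9) * (2 * k + 8)) := by
    have e1 := Nat.add_one_mul_choose_eq (2 * k + 8) (k + 3)
    have e2 := Nat.choose_mul_succ_eq (2 * k + 7) (k + 3)
    have e3 : 2 * k + 7 + 1 - (k + 3) = k + 5 := by omega
    rw [e3] at e2
    have e1' : ((2 * k + 8 + 1 : ℕ) : ℚ) * ((2 * k + 8).choose (k + 3) : ℚ) =
      ((2 * k + 8 + 1).choose (k + 3 + 1) : ℚ) * ((k + 3 + 1 : ℕ) : ℚ) := by exact_mod_cast e1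
    have e2' : ((2 * k + 7).choose (k + 3) : ℚ) * ((2 * k + 7 + 1 : ℕ) : ℚ) =
      ((2 * k + 8).choose (k + 3) : ℚ) * ((k + 5 : ℕ) : ℚ) := by exact_mod_cast e2
    have e4 : 2 * (k + 1) + 7 = 2 * k + 8 + 1 := by ring
    have e5 : k + 1 + 3 = k + 3 + 1 := by ring
    rw [e4, e5]
    push_cast at e1' e2'
    linear_combination (-(k + 5 : ℚ)) * e1' - (2 * k + 9 : ℚ) * e2'
  have p1 : ((2 * k + 7).choose (k + 3) : ℚ) ≠ 0 := by
    exact_mod_cast (Nat.choose_pos (by omega)).ne'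
  have p2 : ((2 * (k + 1) + 7).choose (k + 1 + 3) : ℚ) ≠ 0 := by
    exact_mod_cast (Nat.choose_pos (by omega)).ne'
  unfold psAlpha
  rw [Nat.cast_choose_two, Nat.cast_choose_two]
  generalize ((2 * k + 7).choose (k + 3) : ℚ) = a at *
  generalize ((2 * (k + 1) + 7).choose (k + 1 + 3) : ℚ) = b at *
  have hb : b = a * ((2 * k + 9) * (2 * k + 8)) / ((k + 4) * (k + 5)) := by
    rw [eq_div_iff (by positivity)]; exact h1
  have q1 : ((k : ℚ) + 4 - 1) ≠ 0 := by
    have : (0 : ℚ) ≤ k := by positivity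
    linarith
  have q2 : ((k : ℚ) + 1 + 4 - 1) ≠ 0 := by
    have : (0 : ℚ) ≤ k := by positivity
    linarith
  have q3 : (k : ℚ) + 4 - 1 = k + 3 := by ring
  have q4 : (k : ℚ) + 1 + 4 - 1 = k + 4 := by ring
  have q5 : (k : ℚ) + 1 + 4 = k + 5 := by ring
  push_cast
  rw [q4, q3, q5, hb]
  have q6 : (2 * (k : ℚ) + 8) = 2 * (k + 4) := by ring
  rw [q6]
  field_simp

theorem psSumUpTo (m K : ℕ) (hK : K ≤ m) :
    ∑ k ∈ Finset.range (K + 1), (psF (m + 1) k * psR (m + 1) - psF m k * psR m) =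
      ((m : ℚ) + 5) * (m + 6) * (m + 7) / (12 * (m + 1) * (m + 2)) *
        (m - 2 * K) * (K + 3) * psF m K := by
  induction K with
  | zero =>
    simp [psF, psR]
    field_simp
    ring
  | succ K ih =>
    rw [Finset.sum_range_succ, ih (by omega)]
    obtain ⟨j, rfl⟩ : ∃ j, m = K + 1 + j := ⟨m - (K + 1), by omega⟩
    have s1 : K + 1 + j - K = j + 1 := by omega
    have s2 : K + 1 + j + 1 - (K + 1) = j + 1 := by omega
    have s3 : K + 1 + j - (K + 1) = j := by omega
    have c1 : ((j : ℚ) + 1) * (j.choose (K + 1) : ℚ) = (j - K) * ((j + 1).choose (K + 1) : ℚ) := by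
      have a := Nat.add_one_mul_choose_eq j K
      have b := Nat.choose_succ_succ' j K
      have a' : ((j + 1 : ℕ) : ℚ) * (j.choose K : ℚ) =
        ((j + 1).choose (K + 1) : ℚ) * ((K + 1 : ℕ) : ℚ) := by exact_mod_cast a
      have b' : ((j + 1).choose (K + 1) : ℚ) = (j.choose K : ℚ) + (j.choose (K + 1) : ℚ) := by
        exact_mod_cast b
      push_cast at a'
      linear_combination (-(j + 1 : ℚ)) * b' - a'
    have c2 : ((j : ℚ) + 1 - K) * ((j + 1).choose K : ℚ) =
        (K + 1) * ((j + 1).choose (K + 1) : ℚ) := by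
      have a := Nat.add_one_mul_choose_eq (j + 1) K
      have b := Nat.choose_succ_succ' (j + 1) K
      have a' : ((j + 1 + 1 : ℕ) : ℚ) * ((j + 1).choose K : ℚ) =
        ((j + 1 + 1).choose (K + 1) : ℚ) * ((K + 1 : ℕ) : ℚ) := by exact_mod_cast a
      have b' : ((j + 1 + 1).choose (K + 1) : ℚ) =
          ((j + 1).choose K : ℚ) + ((j + 1).choose (K + 1) : ℚ) := by
        exact_mod_cast b
      push_cast at a'
      linear_combination ((K + 1 : ℚ)) * b' + a'
    have c1' : (j.choose (K + 1) : ℚ) = (j - K) * ((j + 1).choose (K + 1) : ℚ) / (j + 1) := by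
      rw [eq_div_iff (by positivity)]; linear_combination c1
    have hα := psAlpha_succ K
    simp only [psF, s1, s2, s3, c1', psR]
    push_cast
    generalize ((j + 1).choose (K + 1) : ℚ) = A at *
    generalize ((j + 1).choose K : ℚ) = B at *
    generalize psAlpha K = x at *
    generalize psAlpha (K + 1) = y at *
    have key : ((K : ℚ) + 1 + j - 2 * K) * (K + 3) * ((-1) ^ K * B * x) =
        (-1) ^ K * ((K + 1) * A) * (2 * (2 * K + 9) * y) := by
      rw [← hα, ← c2]; ring
    rw [mul_assoc, mul_assoc, ← mul_assoc ((K : ℚ) + 1 + j - 2 * K), key, pow_succ]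
    generalize ((-1 : ℚ)) ^ K = e
    field_simp
    ring

theorem ps_closed (m : ℕ) : (∑ k ∈ Finset.range (m + 1), psF m k) * psR m = 1 := by
  induction m with
  | zero => norm_num [psF, psR, psAlpha, Nat.choose]
  | succ m ih =>
    have h := psSumUpTo m m le_rfl
    have z : ((m : ℚ) - 2 * m) * psF m m = 0 := by
      rcases m with _ | m
      · simp
      · simp [psF]
    have z' : psF (m + 1) (m + 1) = 0 := by simp [psF]
    rw [Finset.sum_sub_distrib, ← Finset.sum_mul, ← Finset.sum_mul, ih] at h
    rw [Finset.sum_range_succ, z', add_zero]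
    linear_combination h + ((m : ℚ) + 5) * (m + 6) * (m + 7) / (12 * (m + 1) * (m + 2)) *
        (m + 3) * z

/-- Pfaff–Saalschütz type identity: for all `n ≥ 13`,
`∑_{ℓ=5}^{⌊(n-1)/2⌋} (-1)^{ℓ}·C(n-ℓ-5, ℓ-4)·3/(C(ℓ,2)·C(2ℓ-1,ℓ-1))
  = -1/70 + 12(n-8)/((n-2)(n-3)(n-4)(n-5))`. -/
theorem pfaff_saalschuetz_identity_two (n : ℕ) (hn : 13 ≤ n) :
    ∑ ℓ ∈ Finset.Icc 5 ((n - 1) / 2),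
      (-1 : ℚ) ^ ℓ * ((n - ℓ - 5).choose (ℓ - 4) : ℚ) *
        (3 / ((ℓ.choose 2 : ℚ) * ((2 * ℓ - 1).choose (ℓ - 1) : ℚ))) =
      -1 / 70 + 12 * ((n : ℚ) - 8) /
        (((n : ℚ) - 2) * ((n : ℚ) - 3) * ((n : ℚ) - 4) * ((n : ℚ) - 5)) := by
  obtain ⟨m, rfl⟩ : ∃ m, n = m + 9 := ⟨n - 9, by omega⟩
  have h := ps_closed m
  have hsub : ∑ k ∈ Finset.range (m / 2 + 1), psF m k = ∑ k ∈ Finset.range (m + 1), psF m k := by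
    apply Finset.sum_subset
    · intro k hk
      simp only [Finset.mem_range] at hk ⊢
      omega
    · intro k hk hk'
      simp only [Finset.mem_range] at hk hk'
      rw [psF, Nat.choose_eq_zero_of_lt (by omega)]
      simp
  have e : Finset.Icc 5 ((m + 9 - 1) / 2) = Finset.Ico 5 (m / 2 + 5) := by
    ext x
    simp only [Finset.mem_Icc, Finset.mem_Ico]
    omega
  rw [← hsub, Finset.sum_range_succ'] at h
  have h0 : psF m 0 = 1 / 70 := by norm_num [psF, psAlpha, Nat.choose]
  rw [h0] at h
  rw [e, Finset.sum_Ico_eq_sum_range, Nat.add_sub_cancel]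
  have hs : ∀ i ∈ Finset.range (m / 2), (-1 : ℚ) ^ (5 + i) *
      ((m + 9 - (5 + i) - 5).choose (5 + i - 4) : ℚ) *
        (3 / (((5 + i).choose 2 : ℚ) * ((2 * (5 + i) - 1).choose (5 + i - 1) : ℚ))) =
      psF m (i + 1) := by
    intro i _
    have t1 : m + 9 - (5 + i) - 5 = m - (i + 1) := by omega
    have t2 : 5 + i - 4 = i + 1 := by omega
    have t3 : 2 * (5 + i) - 1 = 2 * (i + 1) + 7 := by omega
    have t4 : 5 + i - 1 = i + 1 + 3 := by omega
    have t5 : 5 + i = i + 1 + 4 := by omega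
    rw [t1, t2, t3, t4, t5, psF, psAlpha, pow_add _ (i + 1) 4]
    norm_num
  rw [Finset.sum_congr rfl hs]
  have hR : psR m ≠ 0 := by unfold psR; positivity
  have h' := eq_div_of_mul_eq hR h
  have u : ((m + 9 : ℕ) : ℚ) - 2 = m + 7 := by push_cast; ring
  have u1 : ((m + 9 : ℕ) : ℚ) - 3 = m + 6 := by push_cast; ring
  have u2 : ((m + 9 : ℕ) : ℚ) - 4 = m + 5 := by push_cast; ring
  have u3 : ((m + 9 : ℕ) : ℚ) - 5 = m + 4 := by push_cast; ring
  have u4 : ((m + 9 : ℕ) : ℚ) - 8 = m + 1 := by push_cast; ring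
  rw [u, u1, u2, u3, u4]
  rw [psR, one_div_div] at h'
  linear_combination h'
end

section
/- For every integer n ≥ 13, the bracket defined on the n-dimensional vector space f_n with basis e_1, …, e_n by [e_1, e_i] = e_{i+1} for 2 ≤ i ≤ n−1, [e_1, e_n] = 0, and, for 2 ≤ i < j ≤ n, [e_i, e_j] = Σ_{r=1}^{n} ( Σ_{ℓ=0}^{⌊(j−i−1)/2⌋} (−1)^ℓ · C(j−i−ℓ−1, ℓ) · α_{i+ℓ, r−j+i+2ℓ+1} ) e_r (extended bilinearly and antisymmetrically) satisfies the Jacobi identity, so that f_n is a Lie algebra over K. -/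
/-- The structure parameters `α_{k,s}` of the filiform Lie algebra `f_n` (the second index is
taken in `ℤ`, with `α_{k,s} = 0` whenever `(k,s)` falls outside the specified assignments). -/
noncomputable def filiformAlpha (K : Type) [Field K] (n : ℕ) (k : ℕ) (s : ℤ) : K :=
  if 2 ≤ k ∧ k ≤ (n - 1) / 2 ∧ s = 2 * (k : ℤ) + 1 then
    3 / ((k.choose 2 : K) * ((2 * k - 1).choose (k - 1) : K))
  else if k = 3 ∧ s = (n : ℤ) - 4 then 1
  else if k = 4 ∧ s = (n : ℤ) - 2 then
    1 / 7 + (10 / 21) * (((n : K) - 7) * ((n : K) - 8)) / (((n : K) - 4) * ((n : K) - 5))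
  else if k = 4 ∧ s = (n : ℤ) ∧ n = 13 then 22105 / 15246
  else if k = 5 ∧ s = (n : ℤ) then
    1 / 42 - 70 * ((n : K) - 8) /
        (11 * ((n : K) - 2) * ((n : K) - 3) * ((n : K) - 4) * ((n : K) - 5)) +
      (25 / 99) * (((n : K) - 6) * ((n : K) - 7) * ((n : K) - 8)) /
        (((n : K) - 2) * ((n : K) - 3) * ((n : K) - 4)) +
      (5 / 66) * (((n : K) - 5) * ((n : K) - 6)) / (((n : K) - 2) * ((n : K) - 3)) -
      (65 / 1386) * (((n : K) - 7) * ((n : K) - 8)) / (((n : K) - 4) * ((n : K) - 5))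
  else 0

/-- The coefficient of `e_r` in `[e_i, e_j]` for `1 ≤ i < j ≤ n` (1-based indices):
`[e_1, e_i] = e_{i+1}` for `2 ≤ i ≤ n-1`, `[e_1, e_n] = 0`, and for `2 ≤ i < j ≤ n` the
coefficient of `e_r` is `∑_{ℓ=0}^{⌊(j-i-1)/2⌋} (-1)^ℓ C(j-i-ℓ-1, ℓ) α_{i+ℓ, r-j+i+2ℓ+1}`. -/
noncomputable def filiformCoeff (K : Type) [Field K] (n i j r : ℕ) : K :=
  if i = 1 then (if 2 ≤ j ∧ j ≤ n - 1 ∧ r = j + 1 then 1 else 0)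
  else if 2 ≤ i ∧ i < j ∧ j ≤ n then
    ∑ ℓ ∈ Finset.range ((j - i - 1) / 2 + 1),
      (-1 : K) ^ ℓ * ((j - i - ℓ - 1).choose ℓ : K) *
        filiformAlpha K n (i + ℓ) ((r : ℤ) - (j : ℤ) + (i : ℤ) + 2 * (ℓ : ℤ) + 1)
  else 0

/-- The full antisymmetrized structure constants of `f_n`. -/
noncomputable def filiformStructConst (K : Type) [Field K] (n i j r : ℕ) : K :=
  if i < j then filiformCoeff K n i j r
  else if j < i then -filiformCoeff K n j i r
  else 0

/-- The bracket of `f_n`, i.e. the bilinear antisymmetric extension of the bracket on the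
basis `e_1, …, e_n` given by the structure constants, realised on `K^n` (the basis vector
`e_i` corresponds to the `i`-th standard basis vector). -/
noncomputable def filiformBracket (K : Type) [Field K] (n : ℕ) (x y : Fin n → K) :
    Fin n → K := fun r =>
  ∑ i : Fin n, ∑ j : Fin n,
    x i * y j * filiformStructConst K n ((i : ℕ) + 1) ((j : ℕ) + 1) ((r : ℕ) + 1)


/-- Recursive form of the alternating binomial sums. -/
def filF {K : Type} [Field K] (A : ℕ → K) : ℕ → ℕ → K
  | 0, _ => 0
  | 1, i => A i
  | (p + 2), i => filF A (p + 1) i - filF A p (i + 1)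

theorem filF_sum {K : Type} [Field K] (A : ℕ → K) (p i : ℕ) :
    ∑ l ∈ Finset.range p, (-1 : K) ^ l * ((p - l - 1).choose l : K) * A (i + l) = filF A p i := by
  induction p using Nat.twoStepInduction generalizing i with
  | zero => simp [filF]
  | one => simp [filF]
  | more p ih0 ih1 =>
    rw [filF, ← ih0, ← ih1, Finset.sum_range_succ', Finset.sum_range_succ,
      Finset.sum_range_succ' _ p]
    have h1 : ∀ l ∈ Finset.range p, (-1 : K) ^ (l + 1) *
        ((p + 2 - (l + 1) - 1).choose (l + 1) : K) * A (i + (l + 1)) =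
        (-1 : K) ^ (l + 1) * ((p + 1 - (l + 1) - 1).choose (l + 1) : K) * A (i + (l + 1))
        - (-1 : K) ^ l * ((p - l - 1).choose l : K) * A (i + 1 + l) := by
      intro l hl
      rw [Finset.mem_range] at hl
      obtain ⟨q, rfl⟩ : ∃ q, p = l + 1 + q := ⟨p - (l + 1), by omega⟩
      have e1 : l + 1 + q + 2 - (l + 1) - 1 = q + 1 := by omega
      have e2 : l + 1 + q + 1 - (l + 1) - 1 = q := by omega
      have e3 : l + 1 + q - l - 1 = q := by omega
      have e4 : i + 1 + l = i + (l + 1) := by omega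
      rw [e1, e2, e3, e4, Nat.choose_succ_succ]
      push_cast
      ring
    rw [Finset.sum_congr rfl h1, Finset.sum_sub_distrib]
    have e5 : p + 2 - (p + 1) - 1 = 0 := by omega
    rw [e5]
    simp
    ring

theorem filF_sum' {K : Type} [Field K] (A : ℕ → K) (p i : ℕ) (hp : 1 ≤ p) :
    ∑ l ∈ Finset.range ((p - 1) / 2 + 1), (-1 : K) ^ l * ((p - l - 1).choose l : K) * A (i + l)
      = filF A p i := by
  rw [← filF_sum]
  apply Finset.sum_subset
  · intro l; simp only [Finset.mem_range]; omega
  · intro l h1 h2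
    simp only [Finset.mem_range] at h1 h2
    rw [Nat.choose_eq_zero_of_lt (by omega)]
    simp

theorem filF_zero {K : Type} [Field K] (p i : ℕ) : filF (fun _ => (0 : K)) p i = 0 := by
  induction p using Nat.twoStepInduction generalizing i with
  | zero => simp [filF]
  | one => simp [filF]
  | more p ih0 ih1 => simp [filF, ih0, ih1]

/-- Structure constants of the (rescaled) positive Witt algebra. -/
noncomputable def filW (K : Type) [Field K] (i j : ℕ) : K :=
  6 * ((i - 2).factorial : K) * ((j - 2).factorial : K) * ((j : K) - i) / ((i + j - 2).factorial : K)

theorem filW_rec (K : Type) [Field K] [CharZero K] (i j : ℕ) (hi : 2 ≤ i) (hj : 2 ≤ j) :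
    filW K i j = filW K (i + 1) j + filW K i (j + 1) := by
  obtain ⟨i, rfl⟩ := Nat.exists_eq_add_of_le' hi
  obtain ⟨j, rfl⟩ := Nat.exists_eq_add_of_le' hj
  have e1 : i + 2 + (j + 2) - 2 = i + j + 2 := by omega
  have e2 : i + 2 + 1 + (j + 2) - 2 = i + j + 2 + 1 := by omega
  have e3 : i + 2 + (j + 2 + 1) - 2 = i + j + 2 + 1 := by omega
  have e4 : i + 2 + 1 - 2 = i + 1 := by omega
  have e5 : j + 2 + 1 - 2 = j + 1 := by omega
  have h0 : ((i + j + 2).factorial : K) ≠ 0 := by exact_mod_cast Nat.factorial_ne_zero _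
  have h1 : ((i : K) + j + 2 + 1) ≠ 0 := by exact_mod_cast Nat.succ_ne_zero (i + j + 2)
  simp only [filW, e1, e2, e3, e4, e5, Nat.add_sub_cancel]
  rw [Nat.factorial_succ (i + j + 2), Nat.factorial_succ i, Nat.factorial_succ j]
  push_cast
  field_simp
  ring

theorem filF_W (K : Type) [Field K] [CharZero K] (A : ℕ → K) (n : ℕ)
    (hA : ∀ k, 2 ≤ k → 2 * k + 1 ≤ n → A k = filW K k (k + 1)) (p i : ℕ) (hi : 2 ≤ i)
    (h : 2 * i + p ≤ n) : filF A p i = filW K i (i + p) := by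
  induction p using Nat.twoStepInduction generalizing i with
  | zero => simp [filF, filW]
  | one => simp [filF, hA i hi h]
  | more p ih0 ih1 =>
    rw [filF, ih1 i hi (by omega), ih0 (i + 1) (by omega) (by omega),
      filW_rec K i (i + (p + 1)) hi (by omega)]
    have e : i + 1 + p = i + (p + 1) := by omega
    rw [e]
    ring_nf

theorem filW_alpha (K : Type) [Field K] [CharZero K] (k : ℕ) (hk : 2 ≤ k) :
    3 / ((k.choose 2 : K) * ((2 * k - 1).choose (k - 1) : K)) = filW K k (k + 1) := by
  obtain ⟨k, rfl⟩ := Nat.exists_eq_add_of_le' hk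
  have e1 : 2 * (k + 2) - 1 = (k + 1) + (k + 2) := by omega
  have e2 : k + 2 - 1 = k + 1 := by omega
  have e3 : k + 2 + 1 - 2 = k + 1 := by omega
  have e4 : k + 2 + (k + 2 + 1) - 2 = (k + 1) + (k + 2) := by omega
  rw [filW, e1, e2, e3, e4, Nat.add_sub_cancel, Nat.cast_choose_two, Nat.cast_add_choose]
  have h0 : (((k + 1) + (k + 2)).factorial : K) ≠ 0 := by exact_mod_cast Nat.factorial_ne_zero _
  have h1 : (k.factorial : K) ≠ 0 := by exact_mod_cast Nat.factorial_ne_zero _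
  have h2 : ((k : K) + 1) ≠ 0 := by exact_mod_cast Nat.succ_ne_zero k
  have h3 : ((k : K) + 1 + 1) ≠ 0 := by exact_mod_cast Nat.succ_ne_zero (k + 1)
  have h4 : ((k : K) + 2) ≠ 0 := by exact_mod_cast Nat.succ_ne_zero (k + 1)
  rw [Nat.factorial_succ (k + 1), Nat.factorial_succ k]
  push_cast
  have h5 : ((k : K) + 2 - 1) = k + 1 := by ring
  rw [h5]
  field_simp
  ring

/-- Parameters of the deformation of weight `n - 11`. -/
noncomputable def filAb (K : Type) [Field K] (n k : ℕ) : K :=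
  if k = 3 then 1
  else if k = 4 then
    1 / 7 + (10 / 21) * (((n : K) - 7) * ((n : K) - 8)) / (((n : K) - 4) * ((n : K) - 5))
  else if k = 5 then
    1 / 42 - 70 * ((n : K) - 8) /
        (11 * ((n : K) - 2) * ((n : K) - 3) * ((n : K) - 4) * ((n : K) - 5)) +
      (25 / 99) * (((n : K) - 6) * ((n : K) - 7) * ((n : K) - 8)) /
        (((n : K) - 2) * ((n : K) - 3) * ((n : K) - 4)) +
      (5 / 66) * (((n : K) - 5) * ((n : K) - 6)) / (((n : K) - 2) * ((n : K) - 3)) -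
      (65 / 1386) * (((n : K) - 7) * ((n : K) - 8)) / (((n : K) - 4) * ((n : K) - 5))
  else 0

/-- Parameters of the deformation of weight `2 (n - 11)`, present only for `n = 13`. -/
noncomputable def filAg (K : Type) [Field K] (n k : ℕ) : K :=
  if k = 4 ∧ n = 13 then 22105 / 15246 else 0

theorem alpha_zero (K : Type) [Field K] [CharZero K] (n k : ℕ) (hn : 13 ≤ n) (hk : 2 ≤ k)
    (hk2 : 2 * k + 1 ≤ n) :
    filiformAlpha K n k (2 * (k : ℤ) + 1) = filW K k (k + 1) := by
  rw [filiformAlpha, if_pos ⟨hk, by omega, rfl⟩, filW_alpha K k hk]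

theorem alpha_one (K : Type) [Field K] (n k : ℕ) (hn : 13 ≤ n) :
    filiformAlpha K n k (2 * (k : ℤ) + 1 + ((n : ℤ) - 11)) = filAb K n k := by
  rw [filiformAlpha, if_neg (by omega), filAb]
  by_cases h3 : k = 3
  · rw [if_pos (by omega), if_pos h3]
  rw [if_neg (by omega), if_neg h3]
  by_cases h4 : k = 4
  · rw [if_pos (by omega), if_pos h4]
  rw [if_neg (by omega), if_neg (by omega), if_neg h4]
  by_cases h5 : k = 5
  · rw [if_pos (by omega), if_pos h5]
  rw [if_neg (by omega), if_neg h5]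

theorem alpha_two (K : Type) [Field K] (n k : ℕ) (hn : 13 ≤ n) :
    filiformAlpha K n k (2 * (k : ℤ) + 1 + 2 * ((n : ℤ) - 11)) = filAg K n k := by
  rw [filiformAlpha, if_neg (by omega), filAg, if_neg (by omega), if_neg (by omega)]
  by_cases h4 : k = 4 ∧ n = 13
  · rw [if_pos (by omega), if_pos h4]
  rw [if_neg (by omega), if_neg h4, if_neg (by omega)]

theorem alpha_other (K : Type) [Field K] (n k : ℕ) (d : ℤ) (hn : 13 ≤ n) (h0 : d ≠ 0)
    (h1 : d ≠ (n : ℤ) - 11) (h2 : d ≠ 2 * ((n : ℤ) - 11)) :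
    filiformAlpha K n k (2 * (k : ℤ) + 1 + d) = 0 := by
  rw [filiformAlpha, if_neg (by omega), if_neg (by omega), if_neg (by omega), if_neg (by omega),
    if_neg (by omega)]

/-- Structure constants of weight zero. -/
noncomputable def filC (K : Type) [Field K] (i j : ℕ) : K :=
  if i = 1 then (if j = 1 then 0 else 1) else if j = 1 then -1 else filW K i j

/-- Antisymmetric structure constants generated by the parameters `A`. -/
noncomputable def filB {K : Type} [Field K] (A : ℕ → K) (i j : ℕ) : K :=
  if i = 1 ∨ j = 1 then 0
  else if i < j then filF A (j - i) i
  else if j < i then -filF A (i - j) j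
  else 0

/-- The weight decomposition of the structure constants. -/
noncomputable def filU (K : Type) [Field K] (n i j r : ℕ) : K :=
  (if r = i + j then filC K i j else 0) +
  (if r = i + j + (n - 11) then filB (filAb K n) i j else 0) +
  (if r = i + j + 2 * (n - 11) then filB (filAg K n) i j else 0)

theorem filW_anti (K : Type) [Field K] (i j : ℕ) : filW K i j = -filW K j i := by
  rw [filW, filW, Nat.add_comm j i]; ring

theorem filC_anti (K : Type) [Field K] (i j : ℕ) : filC K i j = -filC K j i := by
  unfold filC
  by_cases hi : i = 1 <;> by_cases hj : j = 1 <;> simp [hi, hj]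
  exact filW_anti K i j

theorem filB_anti {K : Type} [Field K] (A : ℕ → K) (i j : ℕ) : filB A i j = -filB A j i := by
  unfold filB
  by_cases h : i = 1 ∨ j = 1
  · rw [if_pos h, if_pos h.symm]; simp
  have h' : ¬ (j = 1 ∨ i = 1) := fun h' => h h'.symm
  simp only [if_neg h, if_neg h']
  rcases lt_trichotomy i j with h1 | h1 | h1
  · simp [h1, h1.not_gt]
  · simp [h1]
  · simp [h1, h1.not_gt]

theorem filU_anti (K : Type) [Field K] (n i j r : ℕ) : filU K n i j r = -filU K n j i r := by
  unfold filU
  rw [filC_anti K i j, filB_anti _ i j, filB_anti (filAg K n) i j, Nat.add_comm j i]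
  split_ifs <;> ring

theorem filU_self (K : Type) [Field K] (n i r : ℕ) : filU K n i i r = 0 := by
  have h1 : filC K i i = 0 := by
    unfold filC filW; split_ifs <;> simp
  have h2 : ∀ A : ℕ → K, filB A i i = 0 := by
    intro A; unfold filB; split_ifs <;> simp_all
  simp [filU, h1, h2]

theorem coeff_eq (K : Type) [Field K] [CharZero K] (n i j r : ℕ) (hn : 13 ≤ n) (hi : 1 ≤ i)
    (hij : i < j) (hj : j ≤ n) (hr : r ≤ n) : filiformCoeff K n i j r = filU K n i j r := by
  unfold filiformCoeff filU
  by_cases h1 : i = 1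
  · subst h1
    have hC : filC K 1 j = 1 := by simp [filC, show j ≠ 1 by omega]
    have hB : ∀ A : ℕ → K, filB A 1 j = 0 := by intro A; simp [filB]
    rw [if_pos rfl, hC, hB, hB]
    by_cases h : r = 1 + j
    · rw [if_pos (by omega), if_pos h]; simp
    · rw [if_neg (by omega), if_neg h]; simp
  rw [if_neg h1, if_pos (by omega)]
  have hB : ∀ A : ℕ → K, filB A i j = filF A (j - i) i := by
    intro A; rw [filB, if_neg (by omega), if_pos hij]
  have hC : filC K i j = filW K i j := by
    rw [filC, if_neg h1, if_neg (by omega)]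
  have key : ∑ l ∈ Finset.range ((j - i - 1) / 2 + 1), (-1 : K) ^ l *
      ((j - i - l - 1).choose l : K) *
        filiformAlpha K n (i + l) ((r : ℤ) - (j : ℤ) + (i : ℤ) + 2 * (l : ℤ) + 1) =
      filF (fun k => filiformAlpha K n k (2 * (k : ℤ) + 1 + ((r : ℤ) - i - j))) (j - i) i := by
    rw [← filF_sum' _ _ _ (by omega)]
    apply Finset.sum_congr rfl
    intro l _
    congr 2
    push_cast
    ring
  rw [key, hB, hB, hC]
  by_cases h0 : r = i + j
  · rw [if_pos h0, if_neg (by omega), if_neg (by omega), add_zero, add_zero]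
    rw [filF_W K _ n _ (j - i) i (by omega) (by omega), show i + (j - i) = j by omega]
    intro k hk hk2
    rw [← alpha_zero K n k hn hk hk2]
    congr 1
    omega
  rw [if_neg h0]
  by_cases h1 : r = i + j + (n - 11)
  · rw [if_pos h1, if_neg (by omega), zero_add, add_zero]
    congr 1
    funext k
    rw [← alpha_one K n k hn]
    congr 1
    omega
  rw [if_neg h1]
  by_cases h2 : r = i + j + 2 * (n - 11)
  · rw [if_pos h2, zero_add, zero_add]
    congr 1
    funext k
    rw [← alpha_two K n k hn]
    congr 1
    omega
  rw [if_neg h2, zero_add, zero_add]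
  rw [← filF_zero (K := K) (j - i) i]
  congr 1
  funext k
  exact alpha_other K n k _ hn (by omega) (by omega) (by omega)

theorem const_eq (K : Type) [Field K] [CharZero K] (n i j r : ℕ) (hn : 13 ≤ n) (hi : 1 ≤ i)
    (hj : 1 ≤ j) (hi' : i ≤ n) (hj' : j ≤ n) (hr : r ≤ n) :
    filiformStructConst K n i j r = filU K n i j r := by
  unfold filiformStructConst
  rcases lt_trichotomy i j with h | h | h
  · rw [if_pos h, coeff_eq K n i j r hn hi h hj' hr]
  · subst h; simp [filU_self]
  · rw [if_neg h.not_gt, if_pos h, coeff_eq K n j i r hn hj h hi' hr, filU_anti K n i j]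

/-- The composite `[[e_a, e_b], e_c]`. -/
noncomputable def filQ (K : Type) [Field K] (n a b c r : ℕ) : K :=
  filC K a b * filU K n (a + b) c r +
  filB (filAb K n) a b * filU K n (a + b + (n - 11)) c r +
  filB (filAg K n) a b * filU K n (a + b + 2 * (n - 11)) c r

theorem filU_big (K : Type) [Field K] (n i j r : ℕ) (h : r < i + j) : filU K n i j r = 0 := by
  rw [filU, if_neg (by omega), if_neg (by omega), if_neg (by omega)]; simp

theorem sum_pick (K : Type) [Field K] (n x : ℕ) (v : K) (f : ℕ → K) (hx : 1 ≤ x)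
    (hf : n < x → f x = 0) :
    ∑ m : Fin n, (if (m : ℕ) + 1 = x then v else 0) * f ((m : ℕ) + 1) = v * f x := by
  by_cases h : n < x
  · rw [hf h, mul_zero]
    apply Finset.sum_eq_zero
    intro m _
    rw [if_neg (by omega), zero_mul]
  · rw [Finset.sum_eq_single (⟨x - 1, by omega⟩ : Fin n)]
    · simp only [show x - 1 + 1 = x by omega, if_true]
    · intro m _ hm
      rw [if_neg, zero_mul]
      intro h'
      apply hm
      ext
      simp only
      omega
    · simp

theorem sum_U (K : Type) [Field K] (n a b c r : ℕ) (ha : 1 ≤ a) (hr : r ≤ n) :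
    ∑ m : Fin n, filU K n a b ((m : ℕ) + 1) * filU K n ((m : ℕ) + 1) c r = filQ K n a b c r := by
  have hbig : ∀ x, n < x → filU K n x c r = 0 := fun x hx => filU_big K n x c r (by omega)
  rw [filQ, ← sum_pick K n (a + b) _ (fun x => filU K n x c r) (by omega) (hbig _),
    ← sum_pick K n (a + b + (n - 11)) _ (fun x => filU K n x c r) (by omega) (hbig _),
    ← sum_pick K n (a + b + 2 * (n - 11)) _ (fun x => filU K n x c r) (by omega) (hbig _),
    ← Finset.sum_add_distrib, ← Finset.sum_add_distrib]
  apply Finset.sum_congr rfl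
  intro m _
  conv_lhs => rw [filU]
  ring

theorem filC_rec (K : Type) [Field K] [CharZero K] (b c : ℕ) (hb : 2 ≤ b) (hc : 2 ≤ c) :
    filC K b c = filC K (b + 1) c + filC K b (c + 1) := by
  simp only [filC, show b ≠ 1 by omega, show c ≠ 1 by omega, show b + 1 ≠ 1 by omega,
    show c + 1 ≠ 1 by omega, if_false]
  exact filW_rec K b c hb hc

theorem filB_rec {K : Type} [Field K] (A : ℕ → K) (b c : ℕ) (hb : 2 ≤ b) (hc : b < c) :
    filB A b c = filB A (b + 1) c + filB A b (c + 1) := by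
  obtain ⟨p, rfl⟩ := Nat.exists_eq_add_of_lt hc
  rw [filB, filB, filB, if_neg (show ¬ (b = 1 ∨ b + p + 1 = 1) by omega),
    if_neg (show ¬ (b + 1 = 1 ∨ b + p + 1 = 1) by omega),
    if_neg (show ¬ (b = 1 ∨ b + p + 1 + 1 = 1) by omega),
    if_pos (show b < b + p + 1 by omega), if_pos (show b < b + p + 1 + 1 by omega)]
  rw [show b + p + 1 - b = p + 1 by omega, show b + p + 1 + 1 - b = p + 2 by omega,
    show b + p + 1 - (b + 1) = p by omega, filF]
  by_cases hp : p = 0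
  · subst hp; simp [filF]
  · rw [if_pos (by omega)]; ring

theorem jac_one (K : Type) [Field K] [CharZero K] (n b c r : ℕ)
    (hb : 2 ≤ b) (hc : b < c) :
    filQ K n 1 b c r + filQ K n b c 1 r + filQ K n c 1 b r = 0 := by
  have hB1 : ∀ (A : ℕ → K) x, filB A 1 x = 0 := by intro A x; simp [filB]
  have hB2 : ∀ (A : ℕ → K) x, filB A x 1 = 0 := by intro A x; simp [filB]
  have hC1 : ∀ x, 2 ≤ x → filC K 1 x = 1 := by
    intro x hx; simp [filC, show x ≠ 1 by omega]
  have hC2 : ∀ x, 2 ≤ x → filC K x 1 = -1 := by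
    intro x hx; simp [filC, show x ≠ 1 by omega]
  have hU : ∀ x, 2 ≤ x → filU K n x 1 r = if r = x + 1 then -1 else 0 := by
    intro x hx; simp [filU, hB2, hC2 x hx]
  rw [filQ, filQ, filQ, hB1, hB1, hB2, hB2, hC1 b hb, hC2 c (by omega), hU _ (by omega),
    hU _ (by omega), hU _ (by omega), filU_anti K n (c + 1) b, filC_rec K b c hb (by omega),
    filB_rec _ b c hb hc, filB_rec (filAg K n) b c hb hc]
  simp only [zero_mul, add_zero]
  rw [filU, filU, Nat.add_comm 1 b,
    show b + 1 + c = b + c + 1 by omega, show b + (c + 1) = b + c + 1 by omega,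
    show b + c + 1 + (n - 11) = b + c + (n - 11) + 1 by omega,
    show b + c + 1 + 2 * (n - 11) = b + c + 2 * (n - 11) + 1 by omega]
  split_ifs <;> ring

theorem jacW (K : Type) [Field K] [CharZero K] (a b c : ℕ)
    (ha : 2 ≤ a) (hb : 2 ≤ b) (hc : 2 ≤ c) :
    filW K a b * filW K (a + b) c + filW K b c * filW K (b + c) a +
      filW K c a * filW K (c + a) b = 0 := by
  have h1 : ((a + b - 2).factorial : K) ≠ 0 := by exact_mod_cast Nat.factorial_ne_zero _
  have h2 : ((b + c - 2).factorial : K) ≠ 0 := by exact_mod_cast Nat.factorial_ne_zero _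
  have h3 : ((c + a - 2).factorial : K) ≠ 0 := by exact_mod_cast Nat.factorial_ne_zero _
  have h4 : ((a + b + c - 2).factorial : K) ≠ 0 := by exact_mod_cast Nat.factorial_ne_zero _
  simp only [filW, show b + c + a = a + b + c by omega, show c + a + b = a + b + c by omega]
  push_cast
  field_simp
  ring

/-- Explicit values of `filC` at small second argument. -/
theorem filC_small (K : Type) [Field K] [CharZero K] (p k : ℕ) (hp : 1 ≤ p) (hk : 2 ≤ k) :
    filC K (p + 2) k = 6 * ((k - 2).factorial : K) * ((k : K) - p - 2) /
      ((p + 1).ascFactorial k : K) := by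
  rw [filC, if_neg (by omega), if_neg (by omega), filW, show p + 2 + k - 2 = p + k by omega,
    Nat.add_sub_cancel, ← Nat.factorial_mul_ascFactorial]
  have h1 : (p.factorial : K) ≠ 0 := by exact_mod_cast Nat.factorial_ne_zero _
  have h2 : ((p + 1).ascFactorial k : K) ≠ 0 := by
    exact_mod_cast (Nat.ascFactorial_pos p k).ne'
  push_cast
  field_simp
  ring

/-- The first order cocycle condition in the finitely many relevant cases. -/
theorem jacB (K : Type) [Field K] [CharZero K] (n a b c : ℕ) (hn : 13 ≤ n)
    (ha : 2 ≤ a) (hb : a < b) (hc : b < c) (h : a + b + c ≤ 11) :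
    (filC K a b * filB (filAb K n) (a + b) c + filB (filAb K n) a b * filC K (a + b + (n - 11)) c) +
    (filC K b c * filB (filAb K n) (b + c) a + filB (filAb K n) b c * filC K (b + c + (n - 11)) a) +
    (filC K c a * filB (filAb K n) (c + a) b + filB (filAb K n) c a * filC K (c + a + (n - 11)) b)
      = 0 := by
  obtain ⟨m, rfl⟩ := Nat.exists_eq_add_of_le' hn
  have hs : ((a = 2 ∧ b = 3 ∧ c = 4) ∨ (a = 2 ∧ b = 3 ∧ c = 5)) ∨
      (a = 2 ∧ b = 3 ∧ c = 6) ∨ (a = 2 ∧ b = 4 ∧ c = 5) := by omega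
  have g : ∀ q : ℕ, 1 ≤ q → ((m : K) + q) ≠ 0 := by
    intro q hq
    exact_mod_cast (show m + q ≠ 0 by omega)
  have g3 := g 3 (by norm_num)
  have g4 := g 4 (by norm_num)
  have g5 := g 5 (by norm_num)
  have g6 := g 6 (by norm_num)
  have g7 := g 7 (by norm_num)
  have g8 := g 8 (by norm_num)
  have g9 := g 9 (by norm_num)
  have g10 := g 10 (by norm_num)
  have g11 := g 11 (by norm_num)
  push_cast at g3 g4 g5 g6 g7 g8 g9 g10 g11
  have t2 : (((m + 13 : ℕ) : K) - 2) = m + 11 := by push_cast; ring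
  have t3 : (((m + 13 : ℕ) : K) - 3) = m + 10 := by push_cast; ring
  have t4 : (((m + 13 : ℕ) : K) - 4) = m + 9 := by push_cast; ring
  have t5 : (((m + 13 : ℕ) : K) - 5) = m + 8 := by push_cast; ring
  have t6 : (((m + 13 : ℕ) : K) - 6) = m + 7 := by push_cast; ring
  have t7 : (((m + 13 : ℕ) : K) - 7) = m + 6 := by push_cast; ring
  have t8 : (((m + 13 : ℕ) : K) - 8) = m + 5 := by push_cast; ring
  have hC : ∀ u v k : ℕ, 3 ≤ u + v → 2 ≤ k → filC K (u + v + (m + 13 - 11)) k =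
      6 * ((k - 2).factorial : K) * ((k : K) - (m + (u + v : ℕ)) - 2) /
        ((m + (u + v) + 1).ascFactorial k : K) := by
    intro u v k h1 h2
    rw [show u + v + (m + 13 - 11) = m + (u + v) + 2 by omega, filC_small K _ k (by omega) h2]
    push_cast
    rfl
  rw [hC a b c (by omega) (by omega), hC b c a (by omega) (by omega),
    hC c a b (by omega) (by omega)]
  rcases hs with (⟨rfl, rfl, rfl⟩ | ⟨rfl, rfl, rfl⟩) | ⟨rfl, rfl, rfl⟩ | ⟨rfl, rfl, rfl⟩
  all_goals
    simp [filC, filB, filF, filAb, filW, Nat.factorial, Nat.ascFactorial, t2, t3, t4, t5, t6, t7,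
      t8, -Nat.cast_add, -Nat.cast_ofNat]
    push_cast
    simp only [add_assoc]
    norm_num only
    field_simp
    ring

theorem jacG (K : Type) [Field K] [CharZero K] :
    (filC K 2 3 * filB (filAg K 13) (2 + 3) 4 + filB (filAg K 13) 2 3 * filC K (2 + 3 + 4) 4
      + filB (filAb K 13) 2 3 * filB (filAb K 13) (2 + 3 + 2) 4) +
    (filC K 3 4 * filB (filAg K 13) (3 + 4) 2 + filB (filAg K 13) 3 4 * filC K (3 + 4 + 4) 2
      + filB (filAb K 13) 3 4 * filB (filAb K 13) (3 + 4 + 2) 2) +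
    (filC K 4 2 * filB (filAg K 13) (4 + 2) 3 + filB (filAg K 13) 4 2 * filC K (4 + 2 + 4) 3
      + filB (filAb K 13) 4 2 * filB (filAb K 13) (4 + 2 + 2) 3) = 0 := by
  simp [filC, filB, filF, filAb, filAg, filW, Nat.factorial]
  norm_num

theorem jac_two (K : Type) [Field K] [CharZero K] (n a b c r : ℕ) (hn : 13 ≤ n) (hr : r ≤ n)
    (ha : 2 ≤ a) (hb : a < b) (hc : b < c) :
    filQ K n a b c r + filQ K n b c a r + filQ K n c a b r = 0 := by
  have hQ : ∀ x y z : ℕ, x + y + z = a + b + c → filQ K n x y z r =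
      (if r = a + b + c then filC K x y * filC K (x + y) z else 0) +
      (if r = a + b + c + (n - 11) then filC K x y * filB (filAb K n) (x + y) z +
        filB (filAb K n) x y * filC K (x + y + (n - 11)) z else 0) +
      (if r = a + b + c + 2 * (n - 11) then filC K x y * filB (filAg K n) (x + y) z +
        filB (filAg K n) x y * filC K (x + y + 2 * (n - 11)) z +
        filB (filAb K n) x y * filB (filAb K n) (x + y + (n - 11)) z else 0) := by
    intro x y z h
    rw [filQ, filU, filU, filU, h, show x + y + (n - 11) + z = a + b + c + (n - 11) by omega,
      show x + y + 2 * (n - 11) + z = a + b + c + 2 * (n - 11) by omega,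
      show a + b + c + (n - 11) + (n - 11) = a + b + c + 2 * (n - 11) by omega,
      if_neg (show ¬ r = a + b + c + (n - 11) + 2 * (n - 11) by omega),
      if_neg (show ¬ r = a + b + c + 2 * (n - 11) + (n - 11) by omega),
      if_neg (show ¬ r = a + b + c + 2 * (n - 11) + 2 * (n - 11) by omega)]
    split_ifs <;> ring
  rw [hQ a b c rfl, hQ b c a (by omega), hQ c a b (by omega)]
  by_cases h0 : r = a + b + c
  · simp only [if_pos h0, if_neg (show ¬ r = a + b + c + (n - 11) by omega),
      if_neg (show ¬ r = a + b + c + 2 * (n - 11) by omega), add_zero]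
    have hC : ∀ x y, 2 ≤ x → 2 ≤ y → filC K x y = filW K x y := by
      intro x y hx hy
      rw [filC, if_neg (by omega), if_neg (by omega)]
    rw [hC a b (by omega) (by omega), hC b c (by omega) (by omega), hC c a (by omega) (by omega),
      hC (a + b) c (by omega) (by omega), hC (b + c) a (by omega) (by omega),
      hC (c + a) b (by omega) (by omega)]
    exact jacW K a b c (by omega) (by omega) (by omega)
  simp only [if_neg h0, zero_add]
  by_cases h1 : r = a + b + c + (n - 11)
  · simp only [if_pos h1, if_neg (show ¬ r = a + b + c + 2 * (n - 11) by omega), add_zero]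
    exact jacB K n a b c hn ha hb hc (by omega)
  simp only [if_neg h1, zero_add]
  by_cases h2 : r = a + b + c + 2 * (n - 11)
  · simp only [if_pos h2]
    obtain rfl : n = 13 := by omega
    obtain rfl : a = 2 := by omega
    obtain rfl : b = 3 := by omega
    obtain rfl : c = 4 := by omega
    exact jacG K
  · simp only [if_neg h2, add_zero]

theorem jac_sorted (K : Type) [Field K] [CharZero K] (n a b c r : ℕ) (hn : 13 ≤ n) (hr : r ≤ n)
    (ha : 1 ≤ a) (hb : a < b) (hc : b < c) :
    filQ K n a b c r + filQ K n b c a r + filQ K n c a b r = 0 := by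
  rcases Nat.lt_or_ge a 2 with h | h
  · obtain rfl : a = 1 := by omega
    exact jac_one K n b c r (by omega) hc
  · exact jac_two K n a b c r hn hr h hb hc

theorem filQ_anti (K : Type) [Field K] (n a b c r : ℕ) :
    filQ K n a b c r = -filQ K n b a c r := by
  rw [filQ, filQ, filC_anti K a b, filB_anti _ a b, filB_anti (filAg K n) a b, Nat.add_comm b a]
  ring

theorem filQ_self (K : Type) [Field K] [CharZero K] (n a c r : ℕ) : filQ K n a a c r = 0 := by
  have := filQ_anti K n a a c r
  exact self_eq_neg.mp this

theorem jac_all (K : Type) [Field K] [CharZero K] (n a b c r : ℕ) (hn : 13 ≤ n) (hr : r ≤ n)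
    (ha : 1 ≤ a) (hb : 1 ≤ b) (hc : 1 ≤ c) :
    filQ K n a b c r + filQ K n b c a r + filQ K n c a b r = 0 := by
  have s1 := filQ_anti K n a b c r
  have s2 := filQ_anti K n b c a r
  have s3 := filQ_anti K n c a b r
  have j1 := jac_sorted K n a b c r hn hr ha
  have j2 := jac_sorted K n b c a r hn hr hb
  have j3 := jac_sorted K n c a b r hn hr hc
  have j4 := jac_sorted K n a c b r hn hr ha
  have j5 := jac_sorted K n b a c r hn hr hb
  have j6 := jac_sorted K n c b a r hn hr hc
  by_cases hab : a = b
  · subst hab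
    rw [filQ_self, s2]; ring
  by_cases hbc : b = c
  · subst hbc
    rw [filQ_self, s1]; ring
  by_cases hac : a = c
  · subst hac
    rw [filQ_self, s1]; ring
  rcases Nat.lt_or_gt_of_ne hab with h1 | h1 <;> rcases Nat.lt_or_gt_of_ne hbc with h2 | h2 <;>
    rcases Nat.lt_or_gt_of_ne hac with h3 | h3
  · exact j1 h1 h2
  · omega
  · have := j4 h3 h2; linear_combination -this + s1 + s2 + s3
  · have := j3 h3 h1; linear_combination this
  · have := j5 h1 h3; linear_combination -this + s1 + s2 + s3
  · have := j2 h2 h3; linear_combination this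
  · omega
  · have := j6 h2 h1; linear_combination -this + s1 + s2 + s3

theorem double_bracket (K : Type) [Field K] [CharZero K] (n : ℕ) (hn : 13 ≤ n)
    (x y z : Fin n → K) (r : Fin n) :
    filiformBracket K n (filiformBracket K n x y) z r =
      ∑ a : Fin n, ∑ b : Fin n, ∑ c : Fin n, x a * y b * z c *
        filQ K n ((a : ℕ) + 1) ((b : ℕ) + 1) ((c : ℕ) + 1) ((r : ℕ) + 1) := by
  have hT : ∀ i j k : Fin n, filiformStructConst K n ((i : ℕ) + 1) ((j : ℕ) + 1) ((k : ℕ) + 1) =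
      filU K n ((i : ℕ) + 1) ((j : ℕ) + 1) ((k : ℕ) + 1) := fun i j k =>
    const_eq K n _ _ _ hn (by omega) (by omega) (by omega) (by omega) (by omega)
  simp only [filiformBracket, hT]
  simp only [← sum_U K n _ _ _ _ (Nat.le_add_left 1 _) (Nat.succ_le_of_lt r.isLt),
    Finset.sum_mul, Finset.mul_sum]
  rw [Finset.sum_comm]
  calc _ = ∑ c : Fin n, ∑ a : Fin n, ∑ b : Fin n, ∑ m : Fin n, x a * y b * z c *
        (filU K n ((a : ℕ) + 1) ((b : ℕ) + 1) ((m : ℕ) + 1) *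
          filU K n ((m : ℕ) + 1) ((c : ℕ) + 1) ((r : ℕ) + 1)) := by
        apply Finset.sum_congr rfl; intro c _
        rw [Finset.sum_comm]
        apply Finset.sum_congr rfl; intro a _
        rw [Finset.sum_comm]
        apply Finset.sum_congr rfl; intro b _
        apply Finset.sum_congr rfl; intro m _
        ring
    _ = _ := by
        rw [Finset.sum_comm]
        apply Finset.sum_congr rfl; intro a _
        rw [Finset.sum_comm]

/-- For every `n ≥ 13` the bracket of `f_n` satisfies the Jacobi identity, so that `f_n` is
a Lie algebra over any field `K` of characteristic zero. -/
theorem filiform_jacobi (K : Type) [Field K] [CharZero K] (n : ℕ) (hn : 13 ≤ n)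
    (x y z : Fin n → K) :
    filiformBracket K n (filiformBracket K n x y) z +
      filiformBracket K n (filiformBracket K n y z) x +
      filiformBracket K n (filiformBracket K n z x) y = 0 := by
  funext r
  simp only [Pi.add_apply, Pi.zero_apply]
  rw [double_bracket K n hn x y z, double_bracket K n hn y z x, double_bracket K n hn z x y]
  have e1 : ∀ f : Fin n → Fin n → Fin n → K,
      ∑ b, ∑ c, ∑ a, f b c a = ∑ a, ∑ b, ∑ c, f b c a := by
    intro f
    calc _ = ∑ b, ∑ a, ∑ c, f b c a :=
          Finset.sum_congr rfl fun b _ => Finset.sum_comm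
      _ = _ := Finset.sum_comm
  rw [e1 (fun b c a => y b * z c * x a * _), ← e1 (fun a b c => z c * x a * y b * _)]
  simp only [← Finset.sum_add_distrib]
  apply Finset.sum_eq_zero; intro a _
  apply Finset.sum_eq_zero; intro b _
  apply Finset.sum_eq_zero; intro c _
  have := jac_all K n ((a : ℕ) + 1) ((b : ℕ) + 1) ((c : ℕ) + 1) ((r : ℕ) + 1) hn (by omega)
    (by omega) (by omega) (by omega)
  linear_combination (x a * y b * z c) * this
end

section
/- For every integer n ≥ 13 the Lie algebra f_n over a field K of characteristic zero has second Betti number b_2(f_n) = 2; that is, if Z^2 denotes the space of alternating bilinear maps ω : f_n × f_n → K satisfying ω([x,y],z) + ω([y,z],x) + ω([z,x],y) = 0 for all x,y,z, and B^2 ⊆ Z^2 denotes the subspace of maps of the form (x,y) ↦ f([x,y]) for linear functionals f on f_n, then dim_K Z^2 − dim_K B^2 = 2. -/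
/-- The space `Z²` of 2-cocycles of `f_n` with trivial coefficients: alternating bilinear
maps `ω : f_n × f_n → K` with `ω([x,y],z) + ω([y,z],x) + ω([z,x],y) = 0`. -/
noncomputable def filiformZ2 (K : Type) [Field K] (n : ℕ) :
    Submodule K ((Fin n → K) →ₗ[K] (Fin n → K) →ₗ[K] K) where
  carrier := {ω | (∀ x, ω x x = 0) ∧
    ∀ x y z, ω (filiformBracket K n x y) z + ω (filiformBracket K n y z) x +
      ω (filiformBracket K n z x) y = 0}
  add_mem' := by
    intro a b ha hb
    refine ⟨fun x => ?_, fun x y z => ?_⟩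
    · simp [ha.1 x, hb.1 x]
    · have h1 := ha.2 x y z
      have h2 := hb.2 x y z
      simp only [LinearMap.add_apply]
      linear_combination h1 + h2
  zero_mem' := by
    refine ⟨fun x => ?_, fun x y z => ?_⟩ <;> simp
  smul_mem' := by
    intro c ω hω
    refine ⟨fun x => ?_, fun x y z => ?_⟩
    · simp [hω.1 x]
    · have h := hω.2 x y z
      simp only [LinearMap.smul_apply, smul_eq_mul]
      linear_combination c * h

/-- The space `B²` of 2-coboundaries of `f_n` with trivial coefficients: bilinear maps of
the form `(x, y) ↦ f([x,y])` for a linear functional `f` on `f_n`. -/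
noncomputable def filiformB2 (K : Type) [Field K] (n : ℕ) :
    Submodule K ((Fin n → K) →ₗ[K] (Fin n → K) →ₗ[K] K) where
  carrier := {ω | ∃ f : (Fin n → K) →ₗ[K] K,
    ∀ x y, ω x y = f (filiformBracket K n x y)}
  add_mem' := by
    rintro a b ⟨f, hf⟩ ⟨g, hg⟩
    exact ⟨f + g, fun x y => by simp [hf x y, hg x y]⟩
  zero_mem' := ⟨0, by simp⟩
  smul_mem' := by
    rintro c ω ⟨f, hf⟩
    exact ⟨c • f, fun x y => by simp [hf x y]⟩


namespace Filiform

open Nat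

/-- The structure constants of the (rescaled) Witt algebra. -/
noncomputable def cc (K : Type) [Field K] (i j : ℕ) : K :=
  6 * ((i - 2)! : K) * ((j - 2)! : K) * ((j : K) - (i : K)) / ((i + j - 2)! : K)

/-- Solutions of `F(i,j+1) = F(i,j) - F(i+1,j)`, with `j = i + m`. -/
def TT {K : Type} [Field K] (a : ℕ → K) : ℕ → ℕ → K
  | 0, _ => 0
  | 1, i => a i
  | m + 2, i => TT a (m + 1) i - TT a m (i + 1)

/-- Antisymmetric version of `TT`. -/
def phi {K : Type} [Field K] (a : ℕ → K) (i j : ℕ) : K :=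
  if i < j then TT a (j - i) i else -TT a (i - j) j

/-- Base parameters. -/
noncomputable def a0 (K : Type) [Field K] (k : ℕ) : K :=
  3 / ((k.choose 2 : K) * ((2 * k - 1).choose (k - 1) : K))

/-- First-order deformation parameters. -/
noncomputable def a1 (K : Type) [Field K] (n k : ℕ) : K :=
  if k = 3 then 1 else if k = 4 then
    1 / 7 + (10 / 21) * (((n : K) - 7) * ((n : K) - 8)) / (((n : K) - 4) * ((n : K) - 5))
  else if k = 5 then
    1 / 42 - 70 * ((n : K) - 8) /
        (11 * ((n : K) - 2) * ((n : K) - 3) * ((n : K) - 4) * ((n : K) - 5)) +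
      (25 / 99) * (((n : K) - 6) * ((n : K) - 7) * ((n : K) - 8)) /
        (((n : K) - 2) * ((n : K) - 3) * ((n : K) - 4)) +
      (5 / 66) * (((n : K) - 5) * ((n : K) - 6)) / (((n : K) - 2) * ((n : K) - 3)) -
      (65 / 1386) * (((n : K) - 7) * ((n : K) - 8)) / (((n : K) - 4) * ((n : K) - 5))
  else 0

/-- Second-order deformation parameters. -/
noncomputable def a2 (K : Type) [Field K] (n k : ℕ) : K :=
  if k = 4 ∧ n = 13 then 22105 / 15246 else 0

lemma sum_eq_TT {K : Type} [Field K] (a : ℕ → K) : ∀ (m i M : ℕ), m / 2 < M →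
    ∑ l ∈ Finset.range M, (-1 : K) ^ l * ((m - l).choose l : K) * a (i + l) = TT a (m + 1) i := by
  intro m
  induction m using Nat.strong_induction_on with
  | _ m ih =>
    intro i M hM
    obtain ⟨M, rfl⟩ : ∃ M', M = M' + 1 := ⟨M - 1, by omega⟩
    rcases m with _ | _ | m
    · rw [Finset.sum_range_succ', Finset.sum_eq_zero]
      · simp [TT]
      · intro l _
        simp
    · rw [Finset.sum_range_succ', Finset.sum_eq_zero]
      · simp [TT]
      · intro l _
        simp
    · have h1 := ih (m + 1) (by omega) i (M + 1) (by omega)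
      have h2 := ih m (by omega) (i + 1) M (by omega)
      rw [TT, ← h1, ← h2, Finset.sum_range_succ', Finset.sum_range_succ' _ M]
      rw [add_sub_right_comm, ← Finset.sum_sub_distrib]
      congr 1
      · apply Finset.sum_congr rfl
        intro l _
        by_cases hl : l ≤ m
        · have e1 : m + 1 + 1 - (l + 1) = (m - l) + 1 := by omega
          have e2 : m + 1 - (l + 1) = m - l := by omega
          have e3 : i + (l + 1) = i + 1 + l := by omega
          rw [e1, e2, e3, Nat.choose_succ_succ]
          push_cast
          ring
        · have e1 : (m + 1 + 1 - (l + 1)).choose (l + 1) = 0 :=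
            Nat.choose_eq_zero_of_lt (by omega)
          have e2 : (m + 1 - (l + 1)).choose (l + 1) = 0 :=
            Nat.choose_eq_zero_of_lt (by omega)
          have e3 : (m - l).choose l = 0 := Nat.choose_eq_zero_of_lt (by omega)
          rw [e1, e2, e3]
          simp

lemma cc_anti (K : Type) [Field K] (i j : ℕ) : cc K i j = -cc K j i := by
  unfold cc
  rw [add_comm j i]
  ring

lemma phi_anti {K : Type} [Field K] (a : ℕ → K) (i j : ℕ) : phi a i j = -phi a j i := by
  unfold phi
  rcases lt_trichotomy i j with h | h | h
  · rw [if_pos h, if_neg (by omega)]; simp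
  · subst h; simp [TT]
  · rw [if_neg (by omega), if_pos h]

lemma cc_rec (K : Type) [Field K] [CharZero K] (i j : ℕ) (hi : 2 ≤ i) (hj : 2 ≤ j) :
    cc K i j = cc K (i + 1) j + cc K i (j + 1) := by
  obtain ⟨i, rfl⟩ := Nat.exists_eq_add_of_le hi
  obtain ⟨j, rfl⟩ := Nat.exists_eq_add_of_le hj
  unfold cc
  have e1 : 2 + i - 2 = i := by omega
  have e2 : 2 + j - 2 = j := by omega
  have e3 : 2 + i + (2 + j) - 2 = i + j + 2 := by omega
  have e4 : 2 + i + 1 - 2 = i + 1 := by omega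
  have e5 : 2 + j + 1 - 2 = j + 1 := by omega
  have e6 : 2 + i + 1 + (2 + j) - 2 = i + j + 2 + 1 := by omega
  have e7 : 2 + i + (2 + j + 1) - 2 = i + j + 2 + 1 := by omega
  rw [e1, e2, e3, e4, e5, e6, e7, Nat.factorial_succ (i + j + 2), Nat.factorial_succ i,
    Nat.factorial_succ j]
  have h1 : ((i + j + 2)! : K) ≠ 0 := by exact_mod_cast Nat.factorial_ne_zero _
  have h2 : ((i : K) + j + 2 + 1) ≠ 0 := by exact_mod_cast Nat.succ_ne_zero (i + j + 2)
  push_cast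
  field_simp
  ring

lemma phi_rec {K : Type} [Field K] (a : ℕ → K) (i j : ℕ) :
    phi a i j = phi a (i + 1) j + phi a i (j + 1) := by
  have key : ∀ i j, i < j → phi a i j = phi a (i + 1) j + phi a i (j + 1) := by
    intro i j h
    obtain ⟨m, rfl⟩ : ∃ m, j = i + m + 1 := ⟨j - i - 1, by omega⟩
    unfold phi
    rw [if_pos h, if_pos (show i < i + m + 1 + 1 by omega)]
    have e1 : i + m + 1 - i = m + 1 := by omega
    have e2 : i + m + 1 + 1 - i = m + 2 := by omega
    have e3 : i + m + 1 - (i + 1) = m := by omega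
    rw [e1, e2, e3, TT]
    by_cases hm : 0 < m
    · rw [if_pos (by omega)]; ring
    · obtain rfl : m = 0 := by omega
      simp [TT]
  rcases lt_trichotomy i j with h | h | h
  · exact key i j h
  · subst h
    rw [phi_anti a (i + 1) i]
    simp [phi, TT]
  · have := key j i h
    rw [phi_anti, this, phi_anti a (i + 1) j, phi_anti a i (j + 1)]
    ring

lemma a0_eq (K : Type) [Field K] [CharZero K] (k : ℕ) (hk : 2 ≤ k) :
    a0 K k = cc K k (k + 1) := by
  obtain ⟨k, rfl⟩ := Nat.exists_eq_add_of_le' hk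
  unfold a0 cc
  have e1 : 2 * (k + 2) - 1 = (k + 1) + (k + 2) := by omega
  have e2 : k + 2 - 1 = k + 1 := by omega
  have e3 : k + 2 + 1 - 2 = k + 1 := by omega
  have e4 : k + 2 - 2 = k := by omega
  have e5 : k + 2 + (k + 2 + 1) - 2 = (k + 1) + (k + 2) := by omega
  rw [e1, e2, e3, e4, e5, Nat.cast_add_choose, Nat.cast_choose_two, Nat.factorial_succ (k + 1),
    Nat.factorial_succ k]
  have h1 : ((k + 1 + (k + 2))! : K) ≠ 0 := by exact_mod_cast Nat.factorial_ne_zero _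
  have h2 : (k ! : K) ≠ 0 := by exact_mod_cast Nat.factorial_ne_zero _
  have h3 : ((k : K) + 1) ≠ 0 := by exact_mod_cast Nat.succ_ne_zero k
  have h4 : ((k : K) + 1 + 1) ≠ 0 := by exact_mod_cast Nat.succ_ne_zero (k + 1)
  have h5 : ((k : K) + 2) ≠ 0 := by exact_mod_cast Nat.succ_ne_zero (k + 1)
  have h6 : ((k : K) + 2 - 1) ≠ 0 := by
    have : (k : K) + 2 - 1 = k + 1 := by ring
    rwa [this]
  push_cast
  field_simp
  ring

lemma TT_a0 (K : Type) [Field K] [CharZero K] : ∀ (m i : ℕ), 2 ≤ i →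
    TT (a0 K) m i = cc K i (i + m) := by
  intro m
  induction m using Nat.strong_induction_on with
  | _ m ih =>
    intro i hi
    rcases m with _ | _ | m
    · simp [TT, cc]
    · simp [TT, a0_eq K i hi]
    · rw [TT, ih (m + 1) (by omega) i hi, ih m (by omega) (i + 1) (by omega),
        cc_rec K i (i + (m + 1)) hi (by omega)]
      rw [show i + 1 + m = i + (m + 1) by omega, show i + (m + 1) + 1 = i + (m + 2) by omega]
      ring

lemma alpha_eq (K : Type) [Field K] (n k : ℕ) (s : ℤ) (hn : 13 ≤ n) (hk : 2 ≤ k) :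
    filiformAlpha K n k s =
      (if s = 2 * (k : ℤ) + 1 ∧ 2 * k + 1 ≤ n then a0 K k else 0) +
      (if s = 2 * (k : ℤ) + 1 + ((n - 11 : ℕ) : ℤ) then a1 K n k else 0) +
      (if s = 2 * (k : ℤ) + 1 + 4 then a2 K n k else 0) := by
  unfold filiformAlpha
  by_cases h1 : 2 ≤ k ∧ k ≤ (n - 1) / 2 ∧ s = 2 * (k : ℤ) + 1
  · rw [if_pos h1, if_pos (by omega), if_neg (by omega), if_neg (by omega)]
    simp [a0]
  rw [if_neg h1, if_neg (c := s = 2 * (k : ℤ) + 1 ∧ 2 * k + 1 ≤ n) (by omega)]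
  by_cases h2 : k = 3 ∧ s = (n : ℤ) - 4
  · rw [if_pos h2, if_pos (by omega)]
    simp [a1, a2, h2.1]
  rw [if_neg h2]
  by_cases h3 : k = 4 ∧ s = (n : ℤ) - 2
  · rw [if_pos h3, if_pos (by omega), a2]
    by_cases h4 : n = 13
    · rw [if_neg (c := s = 2 * (k : ℤ) + 1 + 4) (by omega)]
      simp [a1, h3.1]
    · rw [if_neg (c := k = 4 ∧ n = 13) (by omega)]
      simp [a1, h3.1]
  rw [if_neg h3]
  by_cases h4 : k = 4 ∧ s = (n : ℤ) ∧ n = 13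
  · rw [if_pos h4, if_neg (by omega), if_pos (by omega), a2, if_pos ⟨h4.1, h4.2.2⟩]
    simp
  rw [if_neg h4]
  by_cases h5 : k = 5 ∧ s = (n : ℤ)
  · rw [if_pos h5, if_pos (by omega)]
    simp [a1, a2, h5.1]
  rw [if_neg h5]
  have h6 : (if s = 2 * (k : ℤ) + 1 + 4 then a2 K n k else 0) = 0 := by
    split_ifs with h
    · rw [a2, if_neg (by omega)]
    · rfl
  have h7 : (if s = 2 * (k : ℤ) + 1 + ((n - 11 : ℕ) : ℤ) then a1 K n k else 0) = 0 := by
    split_ifs with h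
    · rw [a1, if_neg (by omega), if_neg (by omega), if_neg (by omega)]
    · rfl
  rw [h6, h7]
  simp

lemma coeff_eq (K : Type) [Field K] [CharZero K] (n i j r : ℕ) (hn : 13 ≤ n) (hi : 2 ≤ i)
    (hij : i < j) (hj : j ≤ n) (hr : r ≤ n) :
    filiformCoeff K n i j r =
      cc K i j * (if r = i + j then 1 else 0) +
      phi (a1 K n) i j * (if r = i + j + (n - 11) then 1 else 0) +
      phi (a2 K n) i j * (if r = i + j + 4 then 1 else 0) := by
  obtain ⟨m, rfl⟩ : ∃ m, j = i + (m + 1) := ⟨j - i - 1, by omega⟩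
  unfold filiformCoeff phi
  rw [if_neg (by omega), if_pos (by omega), if_pos hij, if_pos hij]
  have e1 : i + (m + 1) - i = m + 1 := by omega
  rw [e1, ← TT_a0 K (m + 1) i hi, show m + 1 - 1 = m by omega,
    ← sum_eq_TT (a0 K) m i (m / 2 + 1) (by omega), ← sum_eq_TT (a1 K n) m i (m / 2 + 1) (by omega),
    ← sum_eq_TT (a2 K n) m i (m / 2 + 1) (by omega), Finset.sum_mul, Finset.sum_mul,
    Finset.sum_mul, ← Finset.sum_add_distrib, ← Finset.sum_add_distrib]
  apply Finset.sum_congr rfl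
  intro l hl
  rw [Finset.mem_range] at hl
  rw [alpha_eq K n (i + l) _ hn (by omega), show m + 1 - l - 1 = m - l by omega]
  have c1 : ((r : ℤ) - ((i + (m + 1) : ℕ) : ℤ) + (i : ℤ) + 2 * (l : ℤ) + 1 =
      2 * ((i + l : ℕ) : ℤ) + 1 ∧ 2 * (i + l) + 1 ≤ n) ↔ r = i + (i + (m + 1)) := by omega
  have c2 : ((r : ℤ) - ((i + (m + 1) : ℕ) : ℤ) + (i : ℤ) + 2 * (l : ℤ) + 1 =
      2 * ((i + l : ℕ) : ℤ) + 1 + ((n - 11 : ℕ) : ℤ)) ↔ r = i + (i + (m + 1)) + (n - 11) := by omega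
  have c3 : ((r : ℤ) - ((i + (m + 1) : ℕ) : ℤ) + (i : ℤ) + 2 * (l : ℤ) + 1 =
      2 * ((i + l : ℕ) : ℤ) + 1 + 4) ↔ r = i + (i + (m + 1)) + 4 := by omega
  simp only [c1, c2, c3]
  simp only [mul_ite, mul_one, mul_zero, mul_add]

/-- The standard basis vector with 1-based index (zero when out of range). -/
def E (K : Type) [Field K] (n i : ℕ) : Fin n → K := fun r => if (r : ℕ) + 1 = i then 1 else 0

lemma E_eq_zero (K : Type) [Field K] (n i : ℕ) (h : n < i) : E K n i = 0 := by
  funext r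
  have := r.2
  simp only [E, Pi.zero_apply]
  rw [if_neg (by omega)]

lemma E_eq_single (K : Type) [Field K] (n : ℕ) (i : Fin n) :
    E K n ((i : ℕ) + 1) = Pi.single i 1 := by
  funext r
  simp [E, Pi.single_apply, Fin.ext_iff]

/-- The bracket as a bilinear map. -/
noncomputable def B (K : Type) [Field K] (n : ℕ) :
    (Fin n → K) →ₗ[K] (Fin n → K) →ₗ[K] (Fin n → K) :=
  LinearMap.mk₂ K (filiformBracket K n)
    (by intro x x' y; funext r; simp [filiformBracket, add_mul, Finset.sum_add_distrib])
    (by intro c x y; funext r; simp [filiformBracket, Finset.mul_sum, mul_assoc])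
    (by intro x y y'; funext r; simp [filiformBracket, add_mul, mul_add, Finset.sum_add_distrib])
    (by
      intro c x y; funext r
      simp only [filiformBracket, Finset.mul_sum, Pi.smul_apply, smul_eq_mul]
      exact Finset.sum_congr rfl fun i _ => Finset.sum_congr rfl fun j _ => by ring)

lemma B_apply (K : Type) [Field K] (n : ℕ) (x y : Fin n → K) :
    B K n x y = filiformBracket K n x y := rfl

lemma sc_anti (K : Type) [Field K] (n i j r : ℕ) :
    filiformStructConst K n i j r = -filiformStructConst K n j i r := by
  unfold filiformStructConst
  rcases lt_trichotomy i j with h | h | h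
  · rw [if_pos h, if_neg (by omega), if_pos h]; simp
  · subst h; simp
  · rw [if_neg (by omega), if_pos h, if_pos h]

lemma B_anti (K : Type) [Field K] (n : ℕ) (x y : Fin n → K) : B K n x y = -B K n y x := by
  funext r
  simp only [B_apply, filiformBracket, Pi.neg_apply]
  rw [Finset.sum_comm, ← Finset.sum_neg_distrib]
  refine Finset.sum_congr rfl fun i _ => ?_
  rw [← Finset.sum_neg_distrib]
  refine Finset.sum_congr rfl fun j _ => ?_
  rw [sc_anti K n ((j : ℕ) + 1)]
  ring

lemma B_E (K : Type) [Field K] (n i j : ℕ) (hi : 1 ≤ i) (hin : i ≤ n) (hj : 1 ≤ j) (hjn : j ≤ n)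
    (r : Fin n) : B K n (E K n i) (E K n j) r = filiformStructConst K n i j ((r : ℕ) + 1) := by
  obtain ⟨i, rfl⟩ := Nat.exists_eq_add_of_le' hi
  obtain ⟨j, rfl⟩ := Nat.exists_eq_add_of_le' hj
  have := E_eq_single K n ⟨i, by omega⟩
  have := E_eq_single K n ⟨j, by omega⟩
  simp only at *
  simp only [B_apply, filiformBracket, *]
  simp [Pi.single_apply]

lemma B_one (K : Type) [Field K] (n j : ℕ) (hj : 2 ≤ j) :
    B K n (E K n 1) (E K n j) = E K n (j + 1) := by
  by_cases hjn : n < j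
  · rw [E_eq_zero K n j hjn, E_eq_zero K n (j + 1) (by omega)]; simp
  · funext r
    rw [B_E K n 1 j le_rfl (by omega) (by omega) (by omega)]
    have := r.2
    rw [filiformStructConst, if_pos (by omega), filiformCoeff, if_pos rfl, E]
    congr 1
    apply propext
    omega

lemma B_two (K : Type) [Field K] [CharZero K] (n i j : ℕ) (hn : 13 ≤ n) (hi : 2 ≤ i) (hj : 2 ≤ j) :
    B K n (E K n i) (E K n j) = cc K i j • E K n (i + j) +
      phi (a1 K n) i j • E K n (i + j + (n - 11)) + phi (a2 K n) i j • E K n (i + j + 4) := by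
  have key : ∀ i j, 2 ≤ i → i < j → B K n (E K n i) (E K n j) = cc K i j • E K n (i + j) +
      phi (a1 K n) i j • E K n (i + j + (n - 11)) + phi (a2 K n) i j • E K n (i + j + 4) := by
    intro i j hi hij
    by_cases hjn : n < j
    · rw [E_eq_zero K n j hjn, E_eq_zero K n _ (by omega : n < i + j),
        E_eq_zero K n _ (by omega : n < i + j + (n - 11)),
        E_eq_zero K n _ (by omega : n < i + j + 4)]
      simp
    · funext r
      have := r.2
      rw [B_E K n i j (by omega) (by omega) (by omega) (by omega), filiformStructConst,
        if_pos hij, coeff_eq K n i j _ hn hi hij (by omega) (by omega)]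
      simp [E]
  rcases lt_trichotomy i j with h | h | h
  · exact key i j hi h
  · subst h
    have h2 : B K n (E K n i) (E K n i) = 0 := self_eq_neg.mp (B_anti K n _ _)
    rw [h2]
    simp [cc, phi, TT]
  · rw [B_anti, key j i hj h, cc_anti K i j, phi_anti (a1 K n) i j, phi_anti (a2 K n) i j,
      add_comm j i]
    module


lemma cc_asc (K : Type) [Field K] [CharZero K] (k m : ℕ) :
    cc K k (m + 2) = 6 * ((k - 2)! : K) * ((m : K) + 2 - k) / (((m + 1).ascFactorial k : ℕ) : K) := by
  unfold cc
  have e1 : k + (m + 2) - 2 = m + k := by omega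
  have e2 : m + 2 - 2 = m := by omega
  rw [e1, e2, ← Nat.factorial_mul_ascFactorial]
  have h1 : (m ! : K) ≠ 0 := by exact_mod_cast Nat.factorial_ne_zero _
  have h2 : (((m + 1).ascFactorial k : ℕ) : K) ≠ 0 := by
    exact_mod_cast (Nat.ascFactorial_pos m k).ne'
  push_cast
  field_simp

lemma cc_jac (K : Type) [Field K] [CharZero K] (i j k : ℕ) (hi : 2 ≤ i) (hj : 2 ≤ j) (hk : 2 ≤ k) :
    cc K i j * cc K (i + j) k + cc K j k * cc K (j + k) i + cc K k i * cc K (k + i) j = 0 := by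
  unfold cc
  have e1 : i + j + k - 2 = i + j + k - 2 := rfl
  have e2 : j + k + i - 2 = i + j + k - 2 := by omega
  have e3 : k + i + j - 2 = i + j + k - 2 := by omega
  rw [e2, e3]
  have h : ∀ m : ℕ, (m ! : K) ≠ 0 := fun m => by exact_mod_cast Nat.factorial_ne_zero _
  have h1 := h (i + j - 2)
  have h2 := h (j + k - 2)
  have h3 := h (k + i - 2)
  have h4 := h (i + j + k - 2)
  push_cast
  field_simp
  ring

lemma cc2 (K : Type) [Field K] [CharZero K] (m : ℕ) :
    cc K 2 (m + 2) = 6 * (m : K) / (((m : K) + 2) * (m + 1)) := by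
  rw [cc_asc]
  simp [Nat.ascFactorial]
  congr 1
  ring

lemma cc3 (K : Type) [Field K] [CharZero K] (m : ℕ) :
    cc K 3 (m + 2) = 6 * ((m : K) - 1) / (((m : K) + 3) * (m + 2) * (m + 1)) := by
  rw [cc_asc]
  simp [Nat.ascFactorial]
  congr 1 <;> ring

lemma cc4 (K : Type) [Field K] [CharZero K] (m : ℕ) :
    cc K 4 (m + 2) = 12 * ((m : K) - 2) / (((m : K) + 4) * (m + 3) * (m + 2) * (m + 1)) := by
  rw [cc_asc]
  simp [Nat.ascFactorial, Nat.factorial]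
  congr 1 <;> ring

lemma cc5 (K : Type) [Field K] [CharZero K] (m : ℕ) :
    cc K 5 (m + 2) = 36 * ((m : K) - 3) /
      (((m : K) + 5) * (m + 4) * (m + 3) * (m + 2) * (m + 1)) := by
  rw [cc_asc]
  simp [Nat.ascFactorial, Nat.factorial]
  congr 1 <;> ring

lemma cc6 (K : Type) [Field K] [CharZero K] (m : ℕ) :
    cc K 6 (m + 2) = 144 * ((m : K) - 4) /
      (((m : K) + 6) * (m + 5) * (m + 4) * (m + 3) * (m + 2) * (m + 1)) := by
  rw [cc_asc]
  simp [Nat.ascFactorial, Nat.factorial]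
  congr 1 <;> ring

lemma cast_ne (K : Type) [Field K] [CharZero K] (N c : ℕ) (hc : c ≠ 0) : (N : K) + (c : K) ≠ 0 := by
  have : N + c ≠ 0 := by omega
  exact_mod_cast this

/-- The parameter `α_{4,n-2}` with `n = N + 13`. -/
lemma a1_four (K : Type) [Field K] [CharZero K] (N : ℕ) : a1 K (N + 13) 4 =
    1 / 7 + 10 / 21 * (((N : K) + 6) * (N + 5)) / ((N + 9) * (N + 8)) := by
  simp [a1]
  ring

lemma a1_five (K : Type) [Field K] [CharZero K] (N : ℕ) : a1 K (N + 13) 5 =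
    1 / 42 - 70 * ((N : K) + 5) / (11 * (N + 11) * (N + 10) * (N + 9) * (N + 8)) +
      25 / 99 * ((N + 7) * (N + 6) * (N + 5)) / ((N + 11) * (N + 10) * (N + 9)) +
      5 / 66 * ((N + 8) * (N + 7)) / ((N + 11) * (N + 10)) -
      65 / 1386 * ((N + 6) * (N + 5)) / ((N + 9) * (N + 8)) := by
  simp only [a1]
  norm_num
  have e : ∀ c : K, (N : K) + 13 - c = N + (13 - c) := fun c => by ring
  simp only [e]
  norm_num

lemma a1_zero (K : Type) [Field K] (n k : ℕ) (h : k = 2 ∨ 6 ≤ k) : a1 K n k = 0 := by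
  rw [a1, if_neg (by omega), if_neg (by omega), if_neg (by omega)]

lemma a1_three (K : Type) [Field K] (n : ℕ) : a1 K n 3 = 1 := by
  simp [a1]

/-- Symmetric part of the first-order Jacobi expression. -/
noncomputable def jac1 (K : Type) [Field K] (n i j k : ℕ) : K :=
  cc K i j * phi (a1 K n) (i + j) k + phi (a1 K n) i j * cc K (i + j + (n - 11)) k

lemma jac1_zero (K : Type) [Field K] [CharZero K] (n i j k : ℕ) (hn : 13 ≤ n) (hi : 2 ≤ i)
    (hij : i < j) (hjk : j < k) (hs : i + j + k ≤ 11) :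
    jac1 K n i j k + jac1 K n j k i + jac1 K n k i j = 0 := by
  obtain ⟨N, rfl⟩ := Nat.exists_eq_add_of_le' hn
  have hh : (i = 2 ∧ j = 3 ∧ k = 4) ∨ (i = 2 ∧ j = 3 ∧ k = 5) ∨ (i = 2 ∧ j = 3 ∧ k = 6) ∨
    (i = 2 ∧ j = 4 ∧ k = 5) := by omega
  have ed : N + 13 - 11 = N + 2 := by omega
  have n5 := cast_ne K N 5 (by norm_num)
  have n6 := cast_ne K N 6 (by norm_num)
  have n7 := cast_ne K N 7 (by norm_num)
  have n8 := cast_ne K N 8 (by norm_num)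
  have n9 := cast_ne K N 9 (by norm_num)
  have n10 := cast_ne K N 10 (by norm_num)
  have n11 := cast_ne K N 11 (by norm_num)
  have n12 := cast_ne K N 12 (by norm_num)
  have n13 := cast_ne K N 13 (by norm_num)
  push_cast at n5 n6 n7 n8 n9 n10 n11 n12 n13
  have c23 : cc K 2 3 = 1 := by rw [cc2 K 1]; norm_num
  have c24 : cc K 2 4 = 1 := by rw [cc2 K 2]; norm_num
  have c25 : cc K 2 5 = 9 / 10 := by rw [cc2 K 3]; norm_num
  have c26 : cc K 2 6 = 4 / 5 := by rw [cc2 K 4]; norm_num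
  have c34 : cc K 3 4 = 1 / 10 := by rw [cc3 K 2]; norm_num
  have c35 : cc K 3 5 = 1 / 10 := by rw [cc3 K 3]; norm_num
  have c36 : cc K 3 6 = 3 / 35 := by rw [cc3 K 4]; norm_num
  have c45 : cc K 4 5 = 1 / 70 := by rw [cc4 K 3]; norm_num
  have d1 : ∀ x : ℕ, x + (N + 2) = (N + x) + 2 := fun x => by omega
  rcases hh with ⟨rfl, rfl, rfl⟩ | ⟨rfl, rfl, rfl⟩ | ⟨rfl, rfl, rfl⟩ | ⟨rfl, rfl, rfl⟩ <;>
  simp only [jac1, ed, d1, cc_anti K (N + _ + 2) _, cc2, cc3, cc4, cc5, cc6, c23, c24, c25, c26, c34,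
    c35, c36, c45, cc_anti K 4 2, cc_anti K 5 2, cc_anti K 6 2, phi, Nat.reduceAdd, Nat.reduceLT,
    Nat.reduceSub, if_true, if_false, TT, a1_three, a1_four, a1_five,
    a1_zero K _ 2 (by omega), a1_zero K _ 6 (by omega), a1_zero K _ 7 (by omega)] <;>
  push_cast <;> norm_num only [add_assoc] <;> field_simp <;> ring

lemma jac2_zero (K : Type) [Field K] [CharZero K] :
    (cc K 2 3 * phi (a2 K 13) 5 4 + phi (a2 K 13) 2 3 * cc K 9 4 +
      phi (a1 K 13) 2 3 * phi (a1 K 13) 7 4) +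
    (cc K 3 4 * phi (a2 K 13) 7 2 + phi (a2 K 13) 3 4 * cc K 11 2 +
      phi (a1 K 13) 3 4 * phi (a1 K 13) 9 2) +
    (cc K 4 2 * phi (a2 K 13) 6 3 + phi (a2 K 13) 4 2 * cc K 10 3 +
      phi (a1 K 13) 4 2 * phi (a1 K 13) 8 3) = 0 := by
  have c23 : cc K 2 3 = 1 := by rw [cc2 K 1]; norm_num
  have c24 : cc K 2 4 = 1 := by rw [cc2 K 2]; norm_num
  have c34 : cc K 3 4 = 1 / 10 := by rw [cc3 K 2]; norm_num
  rw [cc_anti K 9, cc_anti K 11, cc_anti K 10, cc_anti K 4 2, cc2 K 9, cc3 K 8, cc4 K 7, c23, c24, c34]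
  have h4 := a1_four K 0
  have h5 := a1_five K 0
  simp only [Nat.zero_add] at h4 h5
  simp only [phi, Nat.reduceAdd, Nat.reduceLT,
    Nat.reduceSub, if_true, if_false, TT, a1_three, h4, h5,
    a1_zero K _ 2 (by omega), a1_zero K _ 6 (by omega), a1_zero K _ 7 (by omega)]
  simp [a2]
  norm_num


lemma phi_zero {K : Type} [Field K] (a : ℕ → K) (ha : ∀ k, a k = 0) (i j : ℕ) : phi a i j = 0 := by
  have h : ∀ m i, TT a m i = 0 := by
    intro m
    induction m using Nat.strong_induction_on with
    | _ m ih =>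
      intro i
      rcases m with _ | _ | m
      · rfl
      · exact ha i
      · rw [TT, ih (m + 1) (by omega), ih m (by omega)]; simp
  simp [phi, h]

lemma psi_zero (K : Type) [Field K] (n i j : ℕ) (hn : n ≠ 13) : phi (a2 K n) i j = 0 := by
  apply phi_zero
  intro k
  simp [a2, hn]

lemma odd_coef (K : Type) [Field K] [CharZero K] (m : ℕ) :
    1 + cc K 3 (m + 4) + cc K 2 (m + 4) ≠ 0 := by
  rw [cc3 K (m + 2), cc2 K (m + 2)]
  have n3 := cast_ne K m 3 (by norm_num)
  have n4 := cast_ne K m 4 (by norm_num)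
  have n5 := cast_ne K m 5 (by norm_num)
  push_cast at *
  have h : ((m + 5) * (m + 4) * (m + 3) + 6 * (m + 1) + 6 * (m + 2) * (m + 5) : ℕ) ≠ 0 := by
    positivity
  have h' : ((m : K) + 5) * (m + 4) * (m + 3) + 6 * (m + 1) + 6 * (m + 2) * (m + 5) ≠ 0 := by
    exact_mod_cast h
  norm_num only [add_assoc]
  intro h0
  apply h'
  have e : (m : K) + 2 - 1 = m + 1 := by ring
  rw [e] at h0
  field_simp at h0
  linear_combination h0

/-- The combinatorial cocycle conditions on the values `w i j = ω(e_i, e_j)`, normalised so that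
`w 1 j = 0` for `j < n`. -/
structure IsW (K : Type) [Field K] (n : ℕ) (w : ℕ → ℕ → K) : Prop where
  anti : ∀ i j, w i j = -w j i
  van : ∀ i j, n < i → w i j = 0
  one : ∀ j, 2 ≤ j → j < n → w 1 j = 0
  step : ∀ i j, 2 ≤ i → 2 ≤ j → w (i + 1) j + w i (j + 1) = cc K i j * w 1 (i + j) +
    phi (a1 K n) i j * w 1 (i + j + (n - 11)) + phi (a2 K n) i j * w 1 (i + j + 4)
  cyc : ∀ i j k, 2 ≤ i → 2 ≤ j → 2 ≤ k →
    (cc K i j * w (i + j) k + phi (a1 K n) i j * w (i + j + (n - 11)) k +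
      phi (a2 K n) i j * w (i + j + 4) k) +
    (cc K j k * w (j + k) i + phi (a1 K n) j k * w (j + k + (n - 11)) i +
      phi (a2 K n) j k * w (j + k + 4) i) +
    (cc K k i * w (k + i) j + phi (a1 K n) k i * w (k + i + (n - 11)) j +
      phi (a2 K n) k i * w (k + i + 4) j) = 0

lemma IsW.one' {K : Type} [Field K] {n : ℕ} {w : ℕ → ℕ → K} (h : IsW K n w) (j : ℕ) (hj : 2 ≤ j)
    (hjn : j ≠ n) : w 1 j = 0 := by
  rcases lt_or_gt_of_ne hjn with h1 | h1
  · exact h.one j hj h1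
  · rw [h.anti, h.van j 1 h1, neg_zero]

/-- A homogeneous cochain of degree `p ≥ 8` killed by the differential vanishes. -/
lemma homog_zero (K : Type) [Field K] [CharZero K] (p : ℕ) (hp : 8 ≤ p) (e : ℕ → ℕ → K)
    (anti : ∀ i j, e i j = -e j i)
    (step : ∀ i j, 2 ≤ i → 2 ≤ j → i + j + 1 = p → e (i + 1) j + e i (j + 1) = 0)
    (cyc : 9 ≤ p → cc K 2 3 * e 5 (p - 5) + cc K 3 (p - 5) * e (p - 2) 2 +
      cc K (p - 5) 2 * e (p - 3) 3 = 0) :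
    ∀ i j, 2 ≤ i → 2 ≤ j → i + j = p → e i j = 0 := by
  have alt : ∀ k, k + 4 ≤ p → e (k + 2) (p - 2 - k) = (-1) ^ k * e 2 (p - 2) := by
    intro k
    induction k with
    | zero => intro _; simp
    | succ k ih =>
      intro hk
      have h1 := ih (by omega)
      have h2 := step (k + 2) (p - 3 - k) (by omega) (by omega) (by omega)
      rw [show p - 3 - k + 1 = p - 2 - k by omega, h1] at h2
      rw [show k + 1 + 2 = k + 2 + 1 by omega, show p - 2 - (k + 1) = p - 3 - k by omega, pow_succ]
      linear_combination h2
  have h0 : e 2 (p - 2) = 0 := by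
    rcases Nat.even_or_odd p with hev | hodd
    · have h1 := alt (p - 4) (by omega)
      have hev' : Even (p - 4) := by
        obtain ⟨r, hr⟩ := hev
        exact ⟨r - 2, by omega⟩
      rw [hev'.neg_one_pow, show p - 4 + 2 = p - 2 by omega, show p - 2 - (p - 4) = 2 by omega,
        anti, one_mul] at h1
      exact self_eq_neg.mp h1.symm
    · obtain ⟨r, hr⟩ := hodd
      obtain ⟨m, rfl⟩ : ∃ m, p = m + 9 := ⟨p - 9, by omega⟩
      have hme : Even m := ⟨r - 4, by omega⟩
      have h3 := cyc (by omega)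
      have a1 := alt 3 (by omega)
      have a2 := alt (m + 5) (by omega)
      have a3 := alt (m + 4) (by omega)
      have p2 : (-1 : K) ^ (m + 5) = -1 := by rw [pow_add, hme.neg_one_pow]; norm_num
      have p3 : (-1 : K) ^ (m + 4) = 1 := by rw [pow_add, hme.neg_one_pow]; norm_num
      rw [p2, show m + 9 - 2 - (m + 5) = 2 by omega] at a2
      rw [p3, show m + 9 - 2 - (m + 4) = 3 by omega] at a3
      rw [show m + 9 - 2 - 3 = m + 4 by omega] at a1
      have c23 : cc K 2 3 = 1 := by rw [cc2 K 1]; norm_num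
      rw [show m + 9 - 5 = m + 4 by omega, show m + 9 - 2 = m + 5 + 2 by omega,
        show m + 9 - 3 = m + 4 + 2 by omega, a1, a2, a3, cc_anti K (m + 4) 2, c23] at h3
      have h4 := odd_coef K m
      have h5 : (1 + cc K 3 (m + 4) + cc K 2 (m + 4)) * e 2 (m + 9 - 2) = 0 := by
        linear_combination -h3
      exact (mul_eq_zero.mp h5).resolve_left h4
  intro i j hi hj hij
  obtain ⟨k, rfl⟩ := Nat.exists_eq_add_of_le' hi
  have := alt k (by omega)
  rw [h0, mul_zero, show p - 2 - k = j by omega] at this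
  exact this

lemma IsW.high {K : Type} [Field K] [CharZero K] {n : ℕ} {w : ℕ → ℕ → K} (h : IsW K n w)
    (hn : 13 ≤ n) : ∀ q p, 2 * n + 2 ≤ p + q → 8 ≤ p → (13 ≤ p ∨ w 1 n = 0) →
      ∀ i j, 2 ≤ i → 2 ≤ j → i + j = p →
        w i j = (if p = n + 1 then w 1 n else 0) * cc K i j := by
  intro q
  induction q with
  | zero =>
    intro p hp _ _ i j hi hj hij
    rw [if_neg (by omega), zero_mul]
    by_cases hin : n < i
    · exact h.van i j hin
    · rw [h.anti, h.van j i (by omega), neg_zero]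
  | succ q ih =>
    intro p hp h8 ht i j hi hj hij
    set τ : K := if p = n + 1 then w 1 n else 0 with hτ
    -- higher-degree terms vanish
    have f1 : ∀ i k, 2 ≤ i → 2 ≤ k → i + k = p → w (i + (n - 11)) k = 0 := by
      intro i k hi hk hik
      have := ih (p + (n - 11)) (by omega) (by omega) (ht.imp_left fun h => by omega) (i + (n - 11)) k (by omega) hk
        (by omega)
      rw [this]
      by_cases h12 : p = 12
      · rw [ht.resolve_left (by omega)]; simp
      · rw [if_neg (by omega), zero_mul]
    have f2 : ∀ x y i k, 2 ≤ i → 2 ≤ k → i + k = p →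
        phi (a2 K n) x y * w (i + 4) k = 0 := by
      intro x y i k hi hk hik
      by_cases h13 : n = 13
      · have := ih (p + 4) (by omega) (by omega) (ht.imp_left fun h => by omega) (i + 4) k (by omega) hk (by omega)
        rw [this]
        by_cases h12 : p = 10
        · rw [ht.resolve_left (by omega)]; simp
        · rw [if_neg (by omega), zero_mul, mul_zero]
      · rw [psi_zero K n x y h13, zero_mul]
    have key := homog_zero K p h8 (fun i j => w i j - τ * cc K i j) ?_ ?_ ?_ i j hi hj hij
    · linear_combination key
    · intro i j
      rw [h.anti i j, cc_anti K i j]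
      ring
    · intro i j hi hj hij
      have h1 := h.step i j hi hj
      have g1 : w 1 (i + j) = τ := by
        rw [hτ]
        split_ifs with hp1
        · rw [show i + j = n by omega]
        · exact h.one' _ (by omega) (by omega)
      have g2 : w 1 (i + j + (n - 11)) = 0 := by
        by_cases h12 : i + j + (n - 11) = n
        · rw [h12]; exact ht.resolve_left (by omega)
        · exact h.one' _ (by omega) h12
      have g3 : phi (a2 K n) i j * w 1 (i + j + 4) = 0 := by
        by_cases h13 : n = 13
        · by_cases h12 : i + j + 4 = n
          · rw [h12, ht.resolve_left (by omega), mul_zero]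
          · rw [h.one' _ (by omega) h12, mul_zero]
        · rw [psi_zero K n i j h13, zero_mul]
      rw [g1, g2, g3] at h1
      have h2 := cc_rec K i j hi hj
      linear_combination h1 + τ * h2
    · intro h9
      have h1 := h.cyc 2 3 (p - 5) (by omega) (by omega) (by omega)
      have h2 := cc_jac K 2 3 (p - 5) (by omega) (by omega) (by omega)
      rw [f1 (2 + 3) (p - 5) (by omega) (by omega) (by omega),
        f1 (3 + (p - 5)) 2 (by omega) (by omega) (by omega),
        f1 (p - 5 + 2) 3 (by omega) (by omega) (by omega),
        f2 _ _ (2 + 3) (p - 5) (by omega) (by omega) (by omega),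
        f2 _ _ (3 + (p - 5)) 2 (by omega) (by omega) (by omega),
        f2 _ _ (p - 5 + 2) 3 (by omega) (by omega) (by omega)] at h1
      have e1 : 3 + (p - 5) = p - 2 := by omega
      have e2 : p - 5 + 2 = p - 3 := by omega
      rw [e1, e2] at h1 h2
      norm_num only at h1 h2
      linear_combination h1 - τ * h2

/-- The obstruction in degree 12 is nonzero. -/
lemma obstruction (K : Type) [Field K] [CharZero K] (n : ℕ) (hn : 13 ≤ n) :
    -cc K 3 4 * phi (a1 K n) 5 6 +
      phi (a1 K n) 3 4 * cc K (7 + (n - 11)) 5 -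
      cc K 4 5 * (phi (a1 K n) 3 8 - phi (a1 K n) 4 7 + phi (a1 K n) 5 6) +
      phi (a1 K n) 4 5 * cc K (9 + (n - 11)) 3 +
      cc K 3 5 * (phi (a1 K n) 4 7 - phi (a1 K n) 5 6) -
      phi (a1 K n) 3 5 * cc K (8 + (n - 11)) 4 ≠ 0 := by
  obtain ⟨N, rfl⟩ := Nat.exists_eq_add_of_le' hn
  have ed : N + 13 - 11 = N + 2 := by omega
  have n8 := cast_ne K N 8 (by norm_num)
  have n9 := cast_ne K N 9 (by norm_num)
  have n10 := cast_ne K N 10 (by norm_num)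
  have n11 := cast_ne K N 11 (by norm_num)
  have n12 := cast_ne K N 12 (by norm_num)
  have n13 := cast_ne K N 13 (by norm_num)
  have n14 := cast_ne K N 14 (by norm_num)
  push_cast at n8 n9 n10 n11 n12 n13 n14
  have c34 : cc K 3 4 = 1 / 10 := by rw [cc3 K 2]; norm_num
  have c35 : cc K 3 5 = 1 / 10 := by rw [cc3 K 3]; norm_num
  have c45 : cc K 4 5 = 1 / 70 := by rw [cc4 K 3]; norm_num
  have d1 : ∀ x : ℕ, x + (N + 2) = (N + x) + 2 := fun x => by omega
  have hpos : 5 * N ^ 8 + 270 * N ^ 7 + 6120 * N ^ 6 + 76290 * N ^ 5 + 571215 * N ^ 4 +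
      2608080 * N ^ 3 + 7073380 * N ^ 2 + 10469760 * N + 5503680 ≠ 0 :=
    (Nat.add_pos_right _ (by norm_num)).ne'
  have hpos' : 5 * (N : K) ^ 8 + 270 * (N : K) ^ 7 + 6120 * (N : K) ^ 6 + 76290 * (N : K) ^ 5 +
      571215 * (N : K) ^ 4 + 2608080 * (N : K) ^ 3 + 7073380 * (N : K) ^ 2 + 10469760 * (N : K) +
      5503680 ≠ 0 := by
    have := (Nat.cast_ne_zero (R := K)).mpr hpos
    push_cast at this
    exact this
  intro h0
  apply hpos'
  simp only [ed, d1, cc_anti K (N + _ + 2) _, cc3, cc4, cc5, c34,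
    c35, c45, phi, Nat.reduceAdd, Nat.reduceLT,
    Nat.reduceSub, if_true, TT, a1_three, a1_four, a1_five,
    a1_zero K _ 6 (by omega), a1_zero K _ 7 (by omega)] at h0
  have key : ∀ X : K, X = 0 → X * (-231 * ((N + 14) * (N + 13) * (N + 12) * (N + 11) * (N + 10) *
    (N + 9) * (N + 8) * (N + 7))) = 0 := fun X hX => by rw [hX, zero_mul]
  have h1 := key _ h0
  rw [← h1]
  push_cast
  norm_num only [add_assoc]
  field_simp
  ring

lemma IsW.t_zero {K : Type} [Field K] [CharZero K] {n : ℕ} {w : ℕ → ℕ → K} (h : IsW K n w)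
    (hn : 13 ≤ n) : w 1 n = 0 := by
  have hi := h.high hn (2 * n + 2)
  have f1 : ∀ i k, 2 ≤ i → 2 ≤ k → i + k = 12 →
      w (i + (n - 11)) k = w 1 n * cc K (i + (n - 11)) k := by
    intro i k hi' hk hik
    rw [hi (n + 1) (by omega) (by omega) (by omega) (i + (n - 11)) k (by omega) hk (by omega),
      if_pos rfl]
  have f2 : ∀ x y i k, 2 ≤ i → 2 ≤ k → i + k = 12 → phi (a2 K n) x y * w (i + 4) k = 0 := by
    intro x y i k hi' hk hik
    by_cases h13 : n = 13
    · rw [hi 16 (by omega) (by omega) (by omega) (i + 4) k (by omega) hk (by omega),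
        if_neg (by omega), zero_mul, mul_zero]
    · rw [psi_zero K n x y h13, zero_mul]
  have s : ∀ i j, 2 ≤ i → 2 ≤ j → i + j = 11 →
      w (i + 1) j + w i (j + 1) = phi (a1 K n) i j * w 1 n := by
    intro i j hi' hj hij
    have g3 : phi (a2 K n) i j * w 1 (i + j + 4) = 0 := by
      by_cases h13 : n = 13
      · rw [h.one' _ (by omega) (by omega), mul_zero]
      · rw [psi_zero K n i j h13, zero_mul]
    rw [h.step i j hi' hj, g3, h.one' (i + j) (by omega) (by omega),
      show i + j + (n - 11) = n by omega]
    ring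
  have s56 := s 5 6 (by omega) (by omega) (by omega)
  have s47 := s 4 7 (by omega) (by omega) (by omega)
  have s38 := s 3 8 (by omega) (by omega) (by omega)
  have w66 : w 6 6 = 0 := self_eq_neg.mp (h.anti 6 6)
  have hc := h.cyc 3 4 5 (by omega) (by omega) (by omega)
  rw [f2 3 4 (3 + 4) 5 (by omega) (by omega) (by omega),
    f2 4 5 (4 + 5) 3 (by omega) (by omega) (by omega),
    f2 5 3 (5 + 3) 4 (by omega) (by omega) (by omega),
    f1 (3 + 4) 5 (by omega) (by omega) (by omega), f1 (4 + 5) 3 (by omega) (by omega) (by omega),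
    f1 (5 + 3) 4 (by omega) (by omega) (by omega)] at hc
  norm_num only at hc s56 s47 s38
  rw [h.anti 7 5, h.anti 9 3, h.anti 8 4, cc_anti K 5 3, phi_anti _ 5 3] at hc
  have ho := obstruction K n hn
  refine (mul_eq_zero.mp (?_ : w 1 n * _ = 0)).resolve_right ho
  have e57 : w 5 7 = phi (a1 K n) 5 6 * w 1 n := by linear_combination s56 - w66
  have e48 : w 4 8 = phi (a1 K n) 4 7 * w 1 n - w 5 7 := by linear_combination s47
  have e39 : w 3 9 = phi (a1 K n) 3 8 * w 1 n - w 4 8 := by linear_combination s38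
  rw [e39, e48, e57] at hc
  linear_combination hc

lemma IsW.zero {K : Type} [Field K] [CharZero K] {n : ℕ} {w : ℕ → ℕ → K} (h : IsW K n w)
    (hn : 13 ≤ n) (h23 : w 2 3 = 0) (h25 : w 2 5 = 0) (i j : ℕ) (hi : 1 ≤ i) (hj : 1 ≤ j) :
    w i j = 0 := by
  have ht := h.t_zero hn
  have h1 : ∀ j, 1 ≤ j → w 1 j = 0 := by
    intro j hj
    rcases eq_or_lt_of_le hj with rfl | hj2
    · exact self_eq_neg.mp (h.anti 1 1)
    · by_cases hjn : j = n
      · rw [hjn, ht]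
      · exact h.one' j hj2 hjn
  by_cases hi1 : i = 1
  · rw [hi1, h1 j hj]
  by_cases hj1 : j = 1
  · rw [hj1, h.anti, h1 i hi, neg_zero]
  by_cases h8 : 8 ≤ i + j
  · rw [h.high hn (2 * n + 2) (i + j) (by omega) h8 (Or.inr ht) i j (by omega) (by omega) rfl, ht]
    simp
  have s : ∀ i j, 2 ≤ i → 2 ≤ j → w (i + 1) j + w i (j + 1) = 0 := by
    intro i j hi hj
    rw [h.step i j hi hj, h1 _ (by omega), h1 _ (by omega), h1 _ (by omega)]
    simp
  have w22 : w 2 2 = 0 := self_eq_neg.mp (h.anti 2 2)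
  have w33 : w 3 3 = 0 := self_eq_neg.mp (h.anti 3 3)
  have w24 : w 2 4 = 0 := by
    have := s 2 3 le_rfl (by omega)
    rw [w33] at this
    simpa using this
  have w34 : w 3 4 = 0 := by
    have := s 2 4 le_rfl (by omega)
    rw [h25] at this
    simpa using this
  have hi5 : i ≤ 5 := by omega
  have hj5 : j ≤ 5 := by omega
  have hi2 : 2 ≤ i := by omega
  have hj2 : 2 ≤ j := by omega
  clear hi hj hi1 hj1
  interval_cases i <;> interval_cases j <;>
  first
  | assumption
  | (rw [h.anti, neg_eq_zero]; assumption)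
  | (exfalso; omega)


lemma lin_zero {K : Type} [Field K] {n : ℕ} (g : (Fin n → K) →ₗ[K] K)
    (h : ∀ i, 1 ≤ i → i ≤ n → g (E K n i) = 0) (x : Fin n → K) : g x = 0 := by
  have : g = 0 := by
    refine (Pi.basisFun K (Fin n)).ext fun i => ?_
    have := h (i + 1) (by omega) i.2
    rw [E_eq_single] at this
    simpa using this
  rw [this]
  rfl

/-- The cyclic expression of the cocycle condition. -/
noncomputable def J {K : Type} [Field K] {n : ℕ} (ω : (Fin n → K) →ₗ[K] (Fin n → K) →ₗ[K] K)
    (x y z : Fin n → K) : K :=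
  ω (B K n x y) z + ω (B K n y z) x + ω (B K n z x) y

lemma J_rot {K : Type} [Field K] {n : ℕ} (ω : (Fin n → K) →ₗ[K] (Fin n → K) →ₗ[K] K)
    (x y z : Fin n → K) : J ω x y z = J ω y z x := by
  unfold J; ring

lemma J_swap {K : Type} [Field K] {n : ℕ} (ω : (Fin n → K) →ₗ[K] (Fin n → K) →ₗ[K] K)
    (x y z : Fin n → K) : J ω x y z = -J ω y x z := by
  unfold J
  rw [B_anti K n x y, B_anti K n y z, B_anti K n z x]
  simp only [map_neg, LinearMap.neg_apply]
  ring

lemma J_zero {K : Type} [Field K] [CharZero K] {n : ℕ}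
    (ω : (Fin n → K) →ₗ[K] (Fin n → K) →ₗ[K] K)
    (h : ∀ i j k, 1 ≤ i → i < j → j < k → k ≤ n → J ω (E K n i) (E K n j) (E K n k) = 0)
    (x y z : Fin n → K) : J ω x y z = 0 := by
  have hdiag : ∀ x y, J ω x x y = 0 := fun x y => self_eq_neg.mp (J_swap ω x x y)
  have h3 : ∀ i j k, 1 ≤ i → i ≤ n → 1 ≤ j → j ≤ n → 1 ≤ k → k ≤ n → i < j →
      J ω (E K n i) (E K n j) (E K n k) = 0 := by
    intro i j k hi hin hj hjn hk hkn hij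
    rcases lt_trichotomy j k with h1 | h1 | h1
    · exact h i j k hi hij h1 hkn
    · subst h1; rw [J_rot]; exact hdiag _ _
    · rcases lt_trichotomy i k with h2 | h2 | h2
      · rw [J_swap, J_rot, h i k j hi h2 h1 hjn, neg_zero]
      · subst h2; rw [← J_rot]; exact hdiag _ _
      · rw [← J_rot, h k i j hk h2 hij hjn]
  have h4 : ∀ i j k, 1 ≤ i → i ≤ n → 1 ≤ j → j ≤ n → 1 ≤ k → k ≤ n →
      J ω (E K n i) (E K n j) (E K n k) = 0 := by
    intro i j k hi hin hj hjn hk hkn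
    rcases lt_trichotomy i j with h1 | h1 | h1
    · exact h3 i j k hi hin hj hjn hk hkn h1
    · subst h1; exact hdiag _ _
    · rw [J_swap, h3 j i k hj hjn hi hin hk hkn h1, neg_zero]
  have ext1 : ∀ y z, (∀ i, 1 ≤ i → i ≤ n → J ω (E K n i) y z = 0) → ∀ x, J ω x y z = 0 := by
    intro y z hx x
    have := lin_zero ((ω.flip z) ∘ₗ ((B K n).flip y) + ω (B K n y z) + (ω.flip y) ∘ₗ (B K n z))
      (fun i hi hin => by simpa [J] using hx i hi hin) x
    simpa [J] using this
  apply ext1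
  intro i hi hin
  rw [J_rot]
  apply ext1
  intro j hj hjn
  rw [J_rot]
  apply ext1
  intro k hk hkn
  exact h4 k i j hk hkn hi hin hj hjn

lemma mem_Z2 {K : Type} [Field K] [CharZero K] {n : ℕ} (hn : 13 ≤ n)
    (ω : (Fin n → K) →ₗ[K] (Fin n → K) →ₗ[K] K) (w : ℕ → ℕ → K)
    (hw : ∀ i j, ω (E K n i) (E K n j) = w i j)
    (halt : ∀ x, ω x x = 0)
    (h1 : ∀ j k, 2 ≤ j → j < k → k ≤ n → w (j + 1) k - w (k + 1) j + (cc K j k * w (j + k) 1 +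
      phi (a1 K n) j k * w (j + k + (n - 11)) 1 + phi (a2 K n) j k * w (j + k + 4) 1) = 0)
    (h2 : ∀ i j k, 2 ≤ i → i < j → j < k → k ≤ n →
      (cc K i j * w (i + j) k + phi (a1 K n) i j * w (i + j + (n - 11)) k +
        phi (a2 K n) i j * w (i + j + 4) k) +
      (cc K j k * w (j + k) i + phi (a1 K n) j k * w (j + k + (n - 11)) i +
        phi (a2 K n) j k * w (j + k + 4) i) +
      (cc K k i * w (k + i) j + phi (a1 K n) k i * w (k + i + (n - 11)) j +
        phi (a2 K n) k i * w (k + i + 4) j) = 0) : ω ∈ filiformZ2 K n := by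
  refine ⟨halt, fun x y z => J_zero ω ?_ x y z⟩
  intro i j k hi hij hjk hk
  unfold J
  by_cases hi1 : i = 1
  · subst hi1
    rw [B_one K n j (by omega), B_anti K n (E K n k) (E K n 1), B_one K n k (by omega),
      B_two K n j k hn (by omega) (by omega)]
    simp only [map_add, map_smul, map_neg, LinearMap.add_apply, LinearMap.smul_apply,
      LinearMap.neg_apply, hw, smul_eq_mul]
    linear_combination h1 j k (by omega) hjk hk
  · rw [B_two K n i j hn (by omega) (by omega), B_two K n j k hn (by omega) (by omega),
      B_two K n k i hn (by omega) (by omega)]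
    simp only [map_add, map_smul, LinearMap.add_apply, LinearMap.smul_apply, hw, smul_eq_mul]
    linear_combination h2 i j k (by omega) hij hjk hk

/-- Values of a cocycle satisfy the combinatorial conditions. -/
lemma isW_of_mem {K : Type} [Field K] [CharZero K] {n : ℕ} (hn : 13 ≤ n)
    (ω : (Fin n → K) →ₗ[K] (Fin n → K) →ₗ[K] K) (hω : ω ∈ filiformZ2 K n)
    (hone : ∀ j, 2 ≤ j → j < n → ω (E K n 1) (E K n j) = 0) :
    IsW K n (fun i j => ω (E K n i) (E K n j)) := by
  have hanti : ∀ x y, ω x y = -ω y x := by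
    intro x y
    have h := hω.1 (x + y)
    simp only [map_add, LinearMap.add_apply, hω.1 x, hω.1 y] at h
    linear_combination h
  have hJ : ∀ x y z, ω (B K n x y) z + ω (B K n y z) x + ω (B K n z x) y = 0 := hω.2
  refine ⟨fun i j => hanti _ _, ?_, hone, ?_, ?_⟩
  · intro i j hi
    simp [E_eq_zero K n i hi]
  · intro i j hi hj
    have h := hJ (E K n 1) (E K n i) (E K n j)
    rw [B_one K n i hi, B_anti K n (E K n j) (E K n 1), B_one K n j hj, B_two K n i j hn hi hj] at h
    simp only [map_add, map_smul, map_neg, LinearMap.add_apply, LinearMap.smul_apply,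
      LinearMap.neg_apply, smul_eq_mul] at h
    rw [hanti (E K n (j + 1)), hanti (E K n (i + j)), hanti (E K n (i + j + (n - 11))),
      hanti (E K n (i + j + 4))] at h
    linear_combination h
  · intro i j k hi hj hk
    have h := hJ (E K n i) (E K n j) (E K n k)
    rw [B_two K n i j hn hi hj, B_two K n j k hn hj hk, B_two K n k i hn hk hi] at h
    simp only [map_add, map_smul, LinearMap.add_apply, LinearMap.smul_apply, smul_eq_mul] at h
    linear_combination h

lemma B2_le_Z2 {K : Type} [Field K] [CharZero K] {n : ℕ} (hn : 13 ≤ n) :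
    filiformB2 K n ≤ filiformZ2 K n := by
  rintro ω ⟨f, hf⟩
  have hf' : ∀ x y, ω x y = f (B K n x y) := hf
  have hBd : ∀ x, B K n x x = 0 := fun x => self_eq_neg.mp (B_anti K n x x)
  refine mem_Z2 hn ω (fun i j => f (B K n (E K n i) (E K n j))) (fun i j => hf' _ _)
    (fun x => by rw [hf', hBd, map_zero]) ?_ ?_
  · intro j k hj hjk hk
    have b1 : ∀ m, 2 ≤ m → f (B K n (E K n m) (E K n 1)) = -f (E K n (m + 1)) := by
      intro m hm
      rw [B_anti, B_one K n m hm, map_neg]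
    rw [b1 _ (by omega), b1 _ (by omega), b1 _ (by omega),
      B_two K n (j + 1) k hn (by omega) (by omega), B_two K n (k + 1) j hn (by omega) (by omega)]
    simp only [map_add, map_smul, smul_eq_mul]
    rw [show j + 1 + k = j + k + 1 by omega, show k + 1 + j = j + k + 1 by omega,
      show j + k + 1 + (n - 11) = j + k + (n - 11) + 1 by omega,
      show j + k + 1 + 4 = j + k + 4 + 1 by omega]
    have r0 := cc_rec K j k (by omega) (by omega)
    have r1 := phi_rec (a1 K n) j k
    have r2 := phi_rec (a2 K n) j k
    rw [cc_anti K (k + 1) j, phi_anti _ (k + 1) j, phi_anti _ (k + 1) j, r0, r1, r2]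
    ring
  · intro i j k hi hij hjk hk
    -- expansion of the double brackets
    have hB : ∀ x z, 2 ≤ x → 2 ≤ z → f (B K n (E K n x) (E K n z)) =
        cc K x z * f (E K n (x + z)) + phi (a1 K n) x z * f (E K n (x + z + (n - 11))) +
          phi (a2 K n) x z * f (E K n (x + z + 4)) := by
      intro x z hx hz
      rw [B_two K n x z hn hx hz]
      simp only [map_add, map_smul, smul_eq_mul]
    have hterm : ∀ x y z, 2 ≤ x → 2 ≤ y → 2 ≤ z → x + y + z = i + j + k →
        cc K x y * f (B K n (E K n (x + y)) (E K n z)) +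
        phi (a1 K n) x y * f (B K n (E K n (x + y + (n - 11))) (E K n z)) +
        phi (a2 K n) x y * f (B K n (E K n (x + y + 4)) (E K n z)) =
        cc K x y * cc K (x + y) z * f (E K n (i + j + k)) +
        jac1 K n x y z * f (E K n (i + j + k + (n - 11))) +
        (cc K x y * phi (a2 K n) (x + y) z + phi (a2 K n) x y * cc K (x + y + 4) z) *
          f (E K n (i + j + k + 4)) +
        phi (a1 K n) x y * phi (a1 K n) (x + y + (n - 11)) z *
          f (E K n (i + j + k + 2 * (n - 11))) := by
      intro x y z hx hy hz hs
      rw [hB _ z (by omega) hz, hB _ z (by omega) hz, hB _ z (by omega) hz, hs,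
        show x + y + (n - 11) + z = i + j + k + (n - 11) by omega,
        show x + y + 4 + z = i + j + k + 4 by omega,
        show i + j + k + (n - 11) + (n - 11) = i + j + k + 2 * (n - 11) by omega,
        E_eq_zero K n (i + j + k + (n - 11) + 4) (by omega),
        E_eq_zero K n (i + j + k + 4 + (n - 11)) (by omega)]
      have hpp : phi (a2 K n) x y * (phi (a2 K n) (x + y + 4) z * f (E K n (i + j + k + 4 + 4))) =
          0 := by
        by_cases h13 : n = 13
        · rw [E_eq_zero K n _ (by omega), map_zero, mul_zero, mul_zero]
        · rw [psi_zero K n _ _ h13, zero_mul]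
      simp only [map_zero, jac1]
      linear_combination hpp
    rw [hterm i j k (by omega) (by omega) (by omega) (by omega),
      hterm j k i (by omega) (by omega) (by omega) (by omega),
      hterm k i j (by omega) (by omega) (by omega) (by omega)]
    have q0 := cc_jac K i j k (by omega) (by omega) (by omega)
    have q1 : (jac1 K n i j k + jac1 K n j k i + jac1 K n k i j) *
        f (E K n (i + j + k + (n - 11))) = 0 := by
      by_cases h11 : i + j + k ≤ 11
      · rw [jac1_zero K n i j k hn hi hij hjk h11, zero_mul]
      · rw [E_eq_zero K n _ (by omega), map_zero, mul_zero]
    have q2 : ((cc K i j * phi (a2 K n) (i + j) k + phi (a2 K n) i j * cc K (i + j + 4) k) +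
        (cc K j k * phi (a2 K n) (j + k) i + phi (a2 K n) j k * cc K (j + k + 4) i) +
        (cc K k i * phi (a2 K n) (k + i) j + phi (a2 K n) k i * cc K (k + i + 4) j)) *
          f (E K n (i + j + k + 4)) +
        (phi (a1 K n) i j * phi (a1 K n) (i + j + (n - 11)) k +
        phi (a1 K n) j k * phi (a1 K n) (j + k + (n - 11)) i +
        phi (a1 K n) k i * phi (a1 K n) (k + i + (n - 11)) j) *
          f (E K n (i + j + k + 2 * (n - 11))) = 0 := by
      by_cases h13 : n = 13
      · by_cases h9 : i + j + k ≤ 9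
        · obtain rfl : i = 2 := by omega
          obtain rfl : j = 3 := by omega
          obtain rfl : k = 4 := by omega
          subst h13
          have h := jac2_zero K
          norm_num only
          linear_combination h * f (E K 13 13)
        · rw [E_eq_zero K n (i + j + k + 4) (by omega),
            E_eq_zero K n (i + j + k + 2 * (n - 11)) (by omega)]
          simp
      · simp only [psi_zero K n _ _ h13]
        rw [E_eq_zero K n (i + j + k + 2 * (n - 11)) (by omega)]
        simp
    linear_combination f (E K n (i + j + k)) * q0 + q1 + q2

/-- The elementary alternating form dual to `e_a ∧ e_b`. -/
noncomputable def wedge (K : Type) [Field K] {n : ℕ} (a b : Fin n) :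
    (Fin n → K) →ₗ[K] (Fin n → K) →ₗ[K] K :=
  LinearMap.mk₂ K (fun x y => x a * y b - x b * y a)
    (by intro x x' y; simp; ring) (by intro c x y; simp; ring)
    (by intro x y y'; simp; ring) (by intro c x y; simp; ring)

lemma wedge_apply (K : Type) [Field K] {n : ℕ} (a b : Fin n) (x y : Fin n → K) :
    wedge K a b x y = x a * y b - x b * y a := rfl

/-- The degree 5 cocycle. -/
noncomputable def om5 (K : Type) [Field K] (n : ℕ) (hn : 13 ≤ n) :
    (Fin n → K) →ₗ[K] (Fin n → K) →ₗ[K] K :=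
  wedge K ⟨1, by omega⟩ ⟨2, by omega⟩

/-- The degree 7 cocycle. -/
noncomputable def om7 (K : Type) [Field K] (n : ℕ) (hn : 13 ≤ n) :
    (Fin n → K) →ₗ[K] (Fin n → K) →ₗ[K] K :=
  wedge K ⟨1, by omega⟩ ⟨4, by omega⟩ - wedge K ⟨2, by omega⟩ ⟨3, by omega⟩

/-- Values of `wedge` on basis vectors. -/
def ww (K : Type) [Field K] (a b i j : ℕ) : K :=
  (if a = i ∧ b = j then 1 else 0) - (if b = i ∧ a = j then 1 else 0)

lemma ww_zero (K : Type) [Field K] (a b i j : ℕ) (h1 : ¬(a = i ∧ b = j)) (h2 : ¬(b = i ∧ a = j)) :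
    ww K a b i j = 0 := by
  simp [ww, h1, h2]

lemma wedge_E (K : Type) [Field K] {n : ℕ} (a b : Fin n) (i j : ℕ) :
    wedge K a b (E K n i) (E K n j) = ww K ((a : ℕ) + 1) ((b : ℕ) + 1) i j := by
  rw [wedge_apply]
  simp only [E, ww, ite_and]
  split_ifs <;> simp

lemma om5_E (K : Type) [Field K] (n : ℕ) (hn : 13 ≤ n) (i j : ℕ) :
    om5 K n hn (E K n i) (E K n j) = ww K 2 3 i j := wedge_E K _ _ i j

lemma om7_E (K : Type) [Field K] (n : ℕ) (hn : 13 ≤ n) (i j : ℕ) :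
    om7 K n hn (E K n i) (E K n j) = ww K 2 5 i j - ww K 3 4 i j := by
  rw [om7, LinearMap.sub_apply, LinearMap.sub_apply, wedge_E, wedge_E]

lemma om5_mem (K : Type) [Field K] [CharZero K] (n : ℕ) (hn : 13 ≤ n) :
    om5 K n hn ∈ filiformZ2 K n := by
  refine mem_Z2 hn _ _ (om5_E K n hn) (fun x => by rw [om5, wedge_apply]; ring) ?_ ?_
  · intro j k hj hjk hk
    rw [ww_zero K 2 3 (j + 1) k (by omega) (by omega), ww_zero K 2 3 (k + 1) j (by omega) (by omega),
      ww_zero K 2 3 (j + k) 1 (by omega) (by omega), ww_zero K 2 3 _ 1 (by omega) (by omega),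
      ww_zero K 2 3 _ 1 (by omega) (by omega)]
    simp
  · intro i j k hi hij hjk hk
    have hz : ∀ x y, 8 ≤ x + y → ww K 2 3 x y = 0 := fun x y h =>
      ww_zero K 2 3 x y (by omega) (by omega)
    rw [hz _ _ (by omega), hz _ _ (by omega), hz _ _ (by omega), hz _ _ (by omega),
      hz _ _ (by omega), hz _ _ (by omega), hz _ _ (by omega), hz _ _ (by omega),
      hz _ _ (by omega)]
    simp

lemma om7_mem (K : Type) [Field K] [CharZero K] (n : ℕ) (hn : 13 ≤ n) :
    om7 K n hn ∈ filiformZ2 K n := by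
  refine mem_Z2 hn _ _ (om7_E K n hn) (fun x => ?_) ?_ ?_
  · rw [om7, LinearMap.sub_apply, LinearMap.sub_apply, wedge_apply, wedge_apply]; ring
  · intro j k hj hjk hk
    have hz : ∀ x, ww K 2 5 x 1 - ww K 3 4 x 1 = 0 := fun x => by
      rw [ww_zero K 2 5 x 1 (by omega) (by omega), ww_zero K 3 4 x 1 (by omega) (by omega), sub_zero]
    rw [hz, hz, hz]
    by_cases h24 : j = 2 ∧ k = 4
    · obtain ⟨rfl, rfl⟩ := h24
      simp [ww]
    · rw [ww_zero K 2 5 (j + 1) k (by omega) (by omega),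
        ww_zero K 2 5 (k + 1) j (by omega) (by omega),
        ww_zero K 3 4 (j + 1) k (by omega) (by omega),
        ww_zero K 3 4 (k + 1) j (by omega) (by omega)]
      simp
  · intro i j k hi hij hjk hk
    have hz : ∀ x y, 8 ≤ x + y → ww K 2 5 x y - ww K 3 4 x y = 0 := fun x y h => by
      rw [ww_zero K 2 5 x y (by omega) (by omega), ww_zero K 3 4 x y (by omega) (by omega), sub_zero]
    rw [hz _ _ (by omega), hz _ _ (by omega), hz _ _ (by omega), hz _ _ (by omega),
      hz _ _ (by omega), hz _ _ (by omega), hz _ _ (by omega), hz _ _ (by omega),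
      hz _ _ (by omega)]
    simp

/-- The map detecting the two cohomology classes. -/
noncomputable def detect (K : Type) [Field K] (n : ℕ) :
    ((Fin n → K) →ₗ[K] (Fin n → K) →ₗ[K] K) →ₗ[K] K × K where
  toFun ω := (ω (E K n 2) (E K n 3) - ω (E K n 1) (E K n 4),
    ω (E K n 2) (E K n 5) - cc K 2 5 * ω (E K n 1) (E K n 6) -
      phi (a1 K n) 2 5 * ω (E K n 1) (E K n (6 + (n - 11))) -
      phi (a2 K n) 2 5 * ω (E K n 1) (E K n 10))
  map_add' := by
    intro ω η
    simp only [LinearMap.add_apply, Prod.mk_add_mk, Prod.mk.injEq]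
    constructor <;> ring
  map_smul' := by
    intro c ω
    simp only [LinearMap.smul_apply, smul_eq_mul, RingHom.id_apply, Prod.smul_mk, Prod.mk.injEq]
    constructor <;> ring

lemma detect_B2 {K : Type} [Field K] [CharZero K] {n : ℕ} (hn : 13 ≤ n)
    (ω : (Fin n → K) →ₗ[K] (Fin n → K) →ₗ[K] K) (hω : ω ∈ filiformB2 K n) : detect K n ω = 0 := by
  obtain ⟨f, hf⟩ := hω
  have hf' : ∀ x y, ω x y = f (B K n x y) := hf
  have c23 : cc K 2 3 = 1 := by rw [cc2 K 1]; norm_num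
  have p23 : phi (a1 K n) 2 3 = 0 := by simp [phi, TT, a1]
  have q23 : phi (a2 K n) 2 3 = 0 := by simp [phi, TT, a2]
  simp only [detect, LinearMap.coe_mk, AddHom.coe_mk, hf']
  rw [B_one K n 4 (by omega), B_one K n 6 (by omega), B_one K n 10 (by omega),
    B_one K n _ (by omega), B_two K n 2 3 hn le_rfl (by omega), B_two K n 2 5 hn le_rfl (by omega),
    c23, p23, q23]
  rw [show 6 + (n - 11) + 1 = 2 + 5 + (n - 11) by omega]
  simp only [map_add, map_smul, smul_eq_mul, Prod.mk_eq_zero]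
  norm_num
  ring

lemma eq_zero_of_detect {K : Type} [Field K] [CharZero K] {n : ℕ} (hn : 13 ≤ n)
    (η : (Fin n → K) →ₗ[K] (Fin n → K) →ₗ[K] K) (hη : η ∈ filiformZ2 K n)
    (hone : ∀ j, 2 ≤ j → j < n → η (E K n 1) (E K n j) = 0)
    (hd : detect K n η = 0) : η = 0 := by
  have hW := isW_of_mem hn η hη hone
  simp only [detect, LinearMap.coe_mk, AddHom.coe_mk, Prod.mk_eq_zero] at hd
  rw [hone 4 (by omega) (by omega), hone 6 (by omega) (by omega), hone 10 (by omega) (by omega),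
    hone (6 + (n - 11)) (by omega) (by omega), mul_zero, mul_zero, mul_zero, sub_zero, sub_zero,
    sub_zero, sub_zero] at hd
  have hz := hW.zero hn hd.1 hd.2
  refine (Pi.basisFun K (Fin n)).ext fun i => (Pi.basisFun K (Fin n)).ext fun j => ?_
  have h := hz (i + 1) (j + 1) (by omega) (by omega)
  rw [E_eq_single, E_eq_single] at h
  rw [Pi.basisFun_apply, Pi.basisFun_apply, LinearMap.zero_apply, LinearMap.zero_apply]
  exact h

lemma exists_functional {K : Type} [Field K] {n : ℕ} (c : ℕ → K) :
    ∃ f : (Fin n → K) →ₗ[K] K, ∀ j, j < n → f (E K n (j + 1)) = c j := by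
  refine ⟨(Pi.basisFun K (Fin n)).constr K (fun i => c i), fun j hj => ?_⟩
  have h1 := E_eq_single K n ⟨j, hj⟩
  simp only at h1
  rw [h1, ← Pi.basisFun_apply]
  exact (Pi.basisFun K (Fin n)).constr_basis K _ _

lemma exists_coboundary {K : Type} [Field K] {n : ℕ} (f : (Fin n → K) →ₗ[K] K) :
    ∃ β : (Fin n → K) →ₗ[K] (Fin n → K) →ₗ[K] K, β ∈ filiformB2 K n ∧
      ∀ x y, β x y = f (B K n x y) :=
  ⟨(B K n).compr₂ f, ⟨f, fun _ _ => rfl⟩, fun _ _ => rfl⟩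

lemma mem_B2_of_detect {K : Type} [Field K] [CharZero K] {n : ℕ} (hn : 13 ≤ n)
    (ω : (Fin n → K) →ₗ[K] (Fin n → K) →ₗ[K] K) (hω : ω ∈ filiformZ2 K n)
    (hd : detect K n ω = 0) : ω ∈ filiformB2 K n := by
  obtain ⟨f, hfE⟩ := exists_functional (n := n) (fun j => ω (E K n 1) (E K n j))
  obtain ⟨β, hβ, hβf⟩ := exists_coboundary f
  have hη : ω + (-1 : K) • β ∈ filiformZ2 K n :=
    Submodule.add_mem _ hω (Submodule.smul_mem _ _ (B2_le_Z2 hn hβ))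
  have hdη : detect K n (ω + (-1 : K) • β) = 0 := by
    rw [map_add, map_smul, hd, detect_B2 hn β hβ, smul_zero, add_zero]
  have hone : ∀ j, 2 ≤ j → j < n → (ω + (-1 : K) • β) (E K n 1) (E K n j) = 0 := by
    intro j hj hjn
    rw [LinearMap.add_apply, LinearMap.add_apply, LinearMap.smul_apply, LinearMap.smul_apply, hβf,
      B_one K n j hj, hfE j hjn, smul_eq_mul]
    ring
  have h0 := eq_zero_of_detect hn _ hη hone hdη
  refine ⟨f, fun x y => ?_⟩
  have h1 : (ω + (-1 : K) • β) x y = 0 := by rw [h0]; rfl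
  rw [LinearMap.add_apply, LinearMap.add_apply, LinearMap.smul_apply, LinearMap.smul_apply, hβf,
    smul_eq_mul] at h1
  have h2 : ω x y = f (B K n x y) := by linear_combination h1
  exact h2

lemma detect_om5 (K : Type) [Field K] [CharZero K] (n : ℕ) (hn : 13 ≤ n) :
    detect K n (om5 K n hn) = (1, 0) := by
  simp only [detect, LinearMap.coe_mk, AddHom.coe_mk, om5_E]
  simp [ww]

lemma detect_om7 (K : Type) [Field K] [CharZero K] (n : ℕ) (hn : 13 ≤ n) :
    detect K n (om7 K n hn) = (0, 1) := by
  simp only [detect, LinearMap.coe_mk, AddHom.coe_mk, om7_E]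
  simp [ww]

lemma finrank_aux (K V : Type) [Field K] [AddCommGroup V] [Module K V] [FiniteDimensional K V]
    (Z W : Submodule K V) (hWZ : W ≤ Z) (d : V →ₗ[K] K × K) (u v : V) (hu : u ∈ Z) (hv : v ∈ Z)
    (hdu : d u = (1, 0)) (hdv : d v = (0, 1)) (h0 : ∀ w ∈ W, d w = 0)
    (h1 : ∀ z ∈ Z, d z = 0 → z ∈ W) : Module.finrank K Z = Module.finrank K W + 2 := by
  obtain ⟨g, hg⟩ : ∃ g : Z →ₗ[K] (K × K), ∀ z, g z = d z.1 :=
    ⟨d.domRestrict _, fun _ => rfl⟩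
  have hsurj : LinearMap.range g = ⊤ := by
    rw [LinearMap.range_eq_top]
    rintro ⟨a, b⟩
    refine ⟨a • ⟨u, hu⟩ + b • ⟨v, hv⟩, ?_⟩
    rw [map_add, map_smul, map_smul, hg, hg, hdu, hdv]
    simp
  have hker : LinearMap.ker g = W.comap Z.subtype := by
    ext ⟨z, hz⟩
    rw [LinearMap.mem_ker, Submodule.mem_comap, Submodule.subtype_apply, hg]
    exact ⟨fun h => h1 z hz h, fun h => h0 z h⟩
  have h1 := LinearMap.finrank_range_add_finrank_ker g
  rw [hsurj, hker, finrank_top, Module.finrank_prod, Module.finrank_self,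
    (Submodule.comapSubtypeEquivOfLe hWZ).finrank_eq] at h1
  omega

lemma finrank_forms (K : Type) [Field K] (n : ℕ)
    (Z W : Submodule K ((Fin n → K) →ₗ[K] (Fin n → K) →ₗ[K] K)) (hWZ : W ≤ Z)
    (d : ((Fin n → K) →ₗ[K] (Fin n → K) →ₗ[K] K) →ₗ[K] K × K)
    (u v : (Fin n → K) →ₗ[K] (Fin n → K) →ₗ[K] K) (hu : u ∈ Z) (hv : v ∈ Z)
    (hdu : d u = (1, 0)) (hdv : d v = (0, 1)) (h0 : ∀ w ∈ W, d w = 0)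
    (h1 : ∀ z ∈ Z, d z = 0 → z ∈ W) : Module.finrank K Z = Module.finrank K W + 2 :=
  finrank_aux K ((Fin n → K) →ₗ[K] (Fin n → K) →ₗ[K] K) Z W hWZ d u v hu hv hdu hdv h0 h1

lemma betti (K : Type) [Field K] [CharZero K] (n : ℕ) (hn : 13 ≤ n) :
    Module.finrank K (filiformZ2 K n) = Module.finrank K (filiformB2 K n) + 2 := by
  apply finrank_forms K n (filiformZ2 K n) (filiformB2 K n)
    (B2_le_Z2 hn) (detect K n) (om5 K n hn) (om7 K n hn) (om5_mem K n hn) (om7_mem K n hn)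
    (detect_om5 K n hn) (detect_om7 K n hn)
  · intro w hw
    exact detect_B2 hn w hw
  · intro z hz h
    exact mem_B2_of_detect hn z hz h

end Filiform

/-- For every `n ≥ 13` the filiform Lie algebra `f_n` over a field of characteristic zero
has second Betti number `b₂(f_n) = dim Z² - dim B² = 2`. -/
theorem filiform_betti_two (K : Type) [Field K] [CharZero K] (n : ℕ) (hn : 13 ≤ n) :
    Module.finrank K (filiformZ2 K n) = Module.finrank K (filiformB2 K n) + 2 := by
  exact Filiform.betti K n hn
end
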